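/- arXiv:1108.4873 — 6 statements merged into one kernel-verified Lean document; each statement's English description precedes it below -/
import Mathlib

section
/- Sphericity: let α = 0, so G = GL(k∞, ℚ_p) and K = 𝔍(O(∞, ℤ_p)). For any irreducible unitary representation ρ of G on a complex Hilbert space 𝓗 (irreducible meaning that the only closed subspaces invariant under all operators ρ(g), g ∈ G, are {0} and 𝓗), the subspace 𝓗^K = {v ∈ 𝓗 : ρ(x)v = v for all x ∈ K} of K-fixed vectors has dimension at most 1. -/
open scoped BigOperators

/-- The identity matrix over `ℚ_p`, with an arbitrary index set. -/
noncomputable def idMat (p : ℕ) [Fact p.Prime] {I : Type*} [DecidableEq I] : I → I → ℚ_[p] :=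
  fun i j => if i = j then 1 else 0

/-- Product of two (possibly infinite) matrices over `ℚ_p`; the sum is a `finsum`, which is
well defined for the finitary matrices considered here. -/
noncomputable def matMul (p : ℕ) [Fact p.Prime] {I : Type*} (A B : I → I → ℚ_[p]) :
    I → I → ℚ_[p] :=
  fun i j => ∑ᶠ l, A i l * B l j

/-- A matrix is *finitary* if it differs from the identity matrix in finitely many entries. -/
def IsFinitary (p : ℕ) [Fact p.Prime] {I : Type*} [DecidableEq I] (A : I → I → ℚ_[p]) : Prop :=
  {x : I × I | A x.1 x.2 ≠ idMat p x.1 x.2}.Finite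

/-- A matrix is invertible if it has a two-sided inverse. -/
def IsInvMat (p : ℕ) [Fact p.Prime] {I : Type*} [DecidableEq I] (A : I → I → ℚ_[p]) : Prop :=
  ∃ B : I → I → ℚ_[p], matMul p A B = idMat p ∧ matMul p B A = idMat p

/-- Membership in the group `G = GL(k∞, ℚ_p)` of invertible matrices indexed by
`{1,…,k} × ℕ` differing from the identity in finitely many entries. -/
def InGL (p : ℕ) [Fact p.Prime] (k : ℕ) (g : (Fin k × ℕ) → (Fin k × ℕ) → ℚ_[p]) : Prop :=
  IsFinitary p g ∧ IsInvMat p g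

/-- Membership in `O(∞, ℤ_p)`: an `ℕ × ℕ` matrix with entries in `ℤ_p` (p-adic norm at most 1),
differing from the identity in finitely many entries, with `uᵗ u = 1`. -/
def IsOrth (p : ℕ) [Fact p.Prime] (u : ℕ → ℕ → ℚ_[p]) : Prop :=
  (∀ i j, ‖u i j‖ ≤ 1) ∧ IsFinitary p u ∧
    ∀ i j, (∑ᶠ l, u l i * u l j) = idMat p i j

/-- The diagonal embedding `𝔍 : O(∞, ℤ_p) → GL(k∞, ℚ_p)`: `u` acts on each of the `k` copies
of the `ℕ`-indexed coordinates. -/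
noncomputable def Jembed (p : ℕ) [Fact p.Prime] (k : ℕ) (u : ℕ → ℕ → ℚ_[p]) :
    (Fin k × ℕ) → (Fin k × ℕ) → ℚ_[p] :=
  fun si tj => if si.1 = tj.1 then u si.2 tj.2 else 0

/-- The matrix `A` agrees with the identity outside of the block `S × S`. -/
def TrivialOff (p : ℕ) [Fact p.Prime] {I : Type*} [DecidableEq I] (S : Set I)
    (A : I → I → ℚ_[p]) : Prop :=
  ∀ i j, i ∉ S ∨ j ∉ S → A i j = idMat p i j

section FinitaryMatrices

variable {p : ℕ} [Fact p.Prime] {I : Type*} [DecidableEq I]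

theorem matMul_eq_of_row {A B : I → I → ℚ_[p]} {i l : I} (h : ∀ m, A i m = idMat p l m) (j : I) :
    matMul p A B i j = B l j := by
  unfold matMul
  rw [finsum_eq_single _ l]
  · simp [h, idMat]
  · intro m hm
    simp [h, idMat, hm.symm]

theorem matMul_eq_of_col {A B : I → I → ℚ_[p]} {j l : I} (h : ∀ m, B m j = idMat p m l) (i : I) :
    matMul p A B i j = A i l := by
  unfold matMul
  rw [finsum_eq_single _ l]
  · simp [h, idMat]
  · intro m hm
    simp [h, idMat, hm]

theorem idMat_matMul (A : I → I → ℚ_[p]) : matMul p (idMat p) A = A := by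
  funext i j
  exact matMul_eq_of_row (fun _ => rfl) j

theorem IsFinitary.exists_trivialOff {A : I → I → ℚ_[p]} (hA : IsFinitary p A) :
    ∃ F : Set I, F.Finite ∧ TrivialOff p F A := by
  refine ⟨_, (hA.image Prod.fst).union (hA.image Prod.snd), fun i j h => ?_⟩
  by_contra hne
  rcases h with h | h
  · exact h (Or.inl ⟨(i, j), hne, rfl⟩)
  · exact h (Or.inr ⟨(i, j), hne, rfl⟩)

theorem TrivialOff.isFinitary {A : I → I → ℚ_[p]} {F : Set I} (hF : F.Finite)
    (hA : TrivialOff p F A) : IsFinitary p A := by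
  refine (hF.prod hF).subset fun x hx => ?_
  by_contra h
  rw [Set.mem_prod, not_and_or] at h
  exact hx (hA x.1 x.2 h)

theorem TrivialOff.mono {A : I → I → ℚ_[p]} {S T : Set I} (hST : S ⊆ T) (hA : TrivialOff p S A) :
    TrivialOff p T A :=
  fun i j h => hA i j (h.imp (fun h' => mt (@hST _) h') fun h' => mt (@hST _) h')

theorem TrivialOff.matMul {A B : I → I → ℚ_[p]} {S : Set I} (hA : TrivialOff p S A)
    (hB : TrivialOff p S B) : TrivialOff p S (matMul p A B) := by
  rintro i j (h | h)
  · rw [matMul_eq_of_row (fun m => hA i m (Or.inl h)), hB i j (Or.inl h)]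
  · rw [matMul_eq_of_col (fun m => hB m j (Or.inr h)), hA i j (Or.inr h)]

theorem TrivialOff.of_inverse {A B : I → I → ℚ_[p]} {S : Set I} (hA : TrivialOff p S A)
    (hAB : _root_.matMul p A B = idMat p) (hBA : _root_.matMul p B A = idMat p) :
    TrivialOff p S B := by
  rintro i j (h | h)
  · rw [← hAB, matMul_eq_of_row (fun m => hA i m (Or.inl h))]
  · rw [← hBA, matMul_eq_of_col (fun m => hA m j (Or.inr h))]

theorem TrivialOff.matMul_comm {A B : I → I → ℚ_[p]} {S T : Set I} (hA : TrivialOff p S A)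
    (hB : TrivialOff p T B) (hST : Disjoint S T) :
    _root_.matMul p A B = _root_.matMul p B A := by
  have row : ∀ {A B : I → I → ℚ_[p]} {S T : Set I}, TrivialOff p S A → TrivialOff p T B →
      Disjoint S T → ∀ i ∈ S, ∀ j, _root_.matMul p A B i j = A i j := by
    intro A B S T hA hB hST i hi j
    unfold _root_.matMul
    rw [finsum_eq_single _ j]
    · by_cases hj : j ∈ T
      · have hjS := hST.notMem_of_mem_right hj
        have hij : i ≠ j := fun h => hjS (h ▸ hi)
        simp [hA i j (Or.inr hjS), idMat, hij]
      · simp [hB j j (Or.inl hj), idMat]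
    · intro l hl
      by_cases hlS : l ∈ S
      · simp [hB l j (Or.inl (hST.notMem_of_mem_left hlS)), idMat, hl]
      · have hil : i ≠ l := fun h => hlS (h ▸ hi)
        simp [hA i l (Or.inr hlS), idMat, hil]
  funext i j
  by_cases hi : i ∈ S
  · rw [row hA hB hST i hi,
      matMul_eq_of_row (fun m => hB i m (Or.inl (hST.notMem_of_mem_left hi)))]
  · rw [matMul_eq_of_row (fun m => hA i m (Or.inl hi))]
    by_cases hi' : i ∈ T
    · rw [row hB hA hST.symm i hi']
    · rw [matMul_eq_of_row (fun m => hB i m (Or.inl hi')), hA i j (Or.inl hi), hB i j (Or.inl hi')]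

theorem matMul_assoc {A B C : I → I → ℚ_[p]} (hA : IsFinitary p A) (hB : IsFinitary p B) :
    matMul p (matMul p A B) C = matMul p A (matMul p B C) := by
  obtain ⟨S, hS, hAS⟩ := hA.exists_trivialOff
  obtain ⟨T, hT, hBT⟩ := hB.exists_trivialOff
  funext i j
  have key : ∀ {A : I → I → ℚ_[p]} (B : I → I → ℚ_[p]), TrivialOff p (S ∪ T) A →
      ∀ l j, l ∈ insert i (S ∪ T) →
      matMul p A B l j = ∑ m ∈ ((hS.union hT).insert i).toFinset, A l m * B m j := by
    intro A B hA l j hl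
    refine finsum_eq_sum_of_support_subset _ fun m hm => ?_
    simp only [Set.Finite.coe_toFinset]
    by_contra hmF
    have hlm : l ≠ m := fun h => hmF (h ▸ hl)
    refine hm ?_
    simp [hA l m (Or.inr fun h => hmF (Set.mem_insert_of_mem _ h)), idMat, hlm]
  have hA' := hAS.mono (Set.subset_union_left (t := T))
  have hB' := hBT.mono (Set.subset_union_right (s := S))
  have hi : i ∈ insert i (S ∪ T) := Set.mem_insert _ _
  rw [key _ (hA'.matMul hB') i j hi, key _ hA' i j hi]
  have h1 : ∀ m, matMul p A B i m = _ := fun m => key B hA' i m hi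
  simp only [h1, Finset.sum_mul]
  rw [Finset.sum_comm]
  refine Finset.sum_congr rfl fun l hl => ?_
  rw [key _ hB' l j (by simpa using hl), Finset.mul_sum]
  exact Finset.sum_congr rfl fun m _ => mul_assoc _ _ _

/-- The permutation matrix of an involution `e` of the index set. -/
noncomputable def permMat (p : ℕ) [Fact p.Prime] {I : Type*} [DecidableEq I] (e : I → I) :
    I → I → ℚ_[p] :=
  fun i j => if i = e j then 1 else 0

theorem permMat_row {e : I → I} (he : Function.Involutive e) (i j : I) :
    permMat p e i j = idMat p (e i) j := by
  simp only [permMat, idMat, he.eq_iff]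

theorem permMat_matMul {e : I → I} (he : Function.Involutive e) (A : I → I → ℚ_[p]) (i j : I) :
    matMul p (permMat p e) A i j = A (e i) j :=
  matMul_eq_of_row (permMat_row he i) j

theorem matMul_permMat (e : I → I) (A : I → I → ℚ_[p]) (i j : I) :
    matMul p A (permMat p e) i j = A i (e j) :=
  matMul_eq_of_col (fun _ => rfl) i

theorem permMat_matMul_self {e : I → I} (he : Function.Involutive e) :
    matMul p (permMat p e) (permMat p e) = idMat p := by
  funext i j
  rw [permMat_matMul he, permMat_row he, he i]

theorem isFinitary_permMat {e : I → I} (he : Function.Involutive e) (hfin : {i | e i ≠ i}.Finite) :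
    IsFinitary p (permMat p e) := by
  refine TrivialOff.isFinitary hfin ?_
  rintro i j (h | h)
  · rw [permMat_row he, not_not.1 h]
  · simp only [permMat, idMat, show e j = j from not_not.1 h]

theorem isOrth_permMat {e : ℕ → ℕ} (he : Function.Involutive e) (hfin : {i | e i ≠ i}.Finite) :
    IsOrth p (permMat p e) := by
  refine ⟨fun i j => ?_, isFinitary_permMat he hfin, fun i j => ?_⟩
  · unfold permMat
    split_ifs <;> simp
  · rw [finsum_eq_single _ (e i)]
    · simp [permMat, idMat, he.injective.eq_iff]
    · intro l hl
      simp [permMat, hl]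

end FinitaryMatrices

theorem jembed_permMat (p : ℕ) [Fact p.Prime] (k : ℕ) (e : ℕ → ℕ) :
    Jembed p k (permMat p e) = permMat p (fun x : Fin k × ℕ => (x.1, e x.2)) := by
  funext x y
  simp only [Jembed, permMat, Prod.ext_iff]
  split_ifs <;> simp_all

section GroupStructure

variable {p : ℕ} [Fact p.Prime] {k : ℕ}

theorem InGL.matMul {A B : (Fin k × ℕ) → (Fin k × ℕ) → ℚ_[p]} (hA : InGL p k A)
    (hB : InGL p k B) : InGL p k (matMul p A B) := by
  have closed : ∀ {A B : (Fin k × ℕ) → (Fin k × ℕ) → ℚ_[p]}, IsFinitary p A → IsFinitary p B →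
      IsFinitary p (_root_.matMul p A B) := by
    intro A B hA hB
    obtain ⟨S, hS, hAS⟩ := hA.exists_trivialOff
    obtain ⟨T, hT, hBT⟩ := hB.exists_trivialOff
    exact ((hAS.mono Set.subset_union_left).matMul (hBT.mono Set.subset_union_right)).isFinitary
      (hS.union hT)
  obtain ⟨hAf, A', hA1, hA2⟩ := hA
  obtain ⟨hBf, B', hB1, hB2⟩ := hB
  have inv : ∀ {A B : (Fin k × ℕ) → (Fin k × ℕ) → ℚ_[p]}, IsFinitary p A →
      _root_.matMul p A B = idMat p → _root_.matMul p B A = idMat p → IsFinitary p B := by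
    intro A B hA h1 h2
    obtain ⟨S, hS, hAS⟩ := hA.exists_trivialOff
    exact (hAS.of_inverse h1 h2).isFinitary hS
  have hA'f := inv hAf hA1 hA2
  have hB'f := inv hBf hB1 hB2
  refine ⟨closed hAf hBf, _root_.matMul p B' A', ?_, ?_⟩
  · rw [matMul_assoc hAf hBf, ← matMul_assoc hBf hB'f, hB1, idMat_matMul, hA1]
  · rw [matMul_assoc hB'f hA'f, ← matMul_assoc hA'f hAf, hA2, idMat_matMul, hB2]

theorem InGL.one : InGL p k (idMat p) := by
  refine ⟨?_, idMat p, idMat_matMul _, idMat_matMul _⟩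
  simp [IsFinitary]

theorem InGL.exists_inverse {A : (Fin k × ℕ) → (Fin k × ℕ) → ℚ_[p]} (hA : InGL p k A) :
    ∃ B, InGL p k B ∧ _root_.matMul p B A = idMat p := by
  obtain ⟨hAf, B, h1, h2⟩ := hA
  obtain ⟨S, hS, hAS⟩ := hAf.exists_trivialOff
  exact ⟨B, ⟨(hAS.of_inverse h1 h2).isFinitary hS, A, h2, h1⟩, h2⟩

theorem inGL_permMat {e : (Fin k × ℕ) → (Fin k × ℕ)} (he : Function.Involutive e)
    (hfin : {i | e i ≠ i}.Finite) : InGL p k (permMat p e) :=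
  ⟨isFinitary_permMat he hfin, permMat p e, permMat_matMul_self he, permMat_matMul_self he⟩

theorem InGL.exists_trivialOff_lt {A : (Fin k × ℕ) → (Fin k × ℕ) → ℚ_[p]} (hA : InGL p k A) :
    ∃ N : ℕ, TrivialOff p {x | x.2 < N} A := by
  obtain ⟨S, hS, hAS⟩ := hA.1.exists_trivialOff
  obtain ⟨N, hN⟩ := (hS.image Prod.snd).bddAbove
  exact ⟨N + 1, hAS.mono fun x hx => Nat.lt_succ_of_le (hN ⟨x, hx, rfl⟩)⟩

variable (p k) in
/-- The group `GL(k∞, ℚ_p)` as a type. -/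
def GLInf : Type := {g : (Fin k × ℕ) → (Fin k × ℕ) → ℚ_[p] // InGL p k g}

noncomputable instance : Group (GLInf p k) :=
  letI : Mul (GLInf p k) := ⟨fun g h => ⟨matMul p g.1 h.1, g.2.matMul h.2⟩⟩
  letI : One (GLInf p k) := ⟨⟨idMat p, InGL.one⟩⟩
  letI : Inv (GLInf p k) :=
    ⟨fun g => ⟨g.2.exists_inverse.choose, g.2.exists_inverse.choose_spec.1⟩⟩
  Group.ofLeftAxioms (fun g h _ => Subtype.ext (matMul_assoc g.2.1 h.2.1))
    (fun g => Subtype.ext (idMat_matMul g.1))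
    (fun g => Subtype.ext g.2.exists_inverse.choose_spec.2)

theorem GLInf.val_mul (g h : GLInf p k) : (g * h).1 = matMul p g.1 h.1 := rfl

end GroupStructure

/-- The involution of `ℕ` exchanging the blocks `[0, N)` and `[M, M + N)`, for `N ≤ M`. -/
def blockSwap (N M x : ℕ) : ℕ :=
  if x < N then x + M else if M ≤ x ∧ x < M + N then x - M else x

theorem blockSwap_involutive {N M : ℕ} (h : N ≤ M) : Function.Involutive (blockSwap N M) := by
  intro x
  unfold blockSwap
  split_ifs <;> omega

theorem blockSwap_support_finite (N M : ℕ) : {x | blockSwap N M x ≠ x}.Finite := by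
  refine (Set.finite_lt_nat (M + N)).subset fun x hx => ?_
  by_contra h
  simp only [Set.mem_ofPred_eq] at h hx
  apply hx
  unfold blockSwap
  split_ifs <;> omega

theorem GLInf.exists_asymptotically_commuting {p : ℕ} [Fact p.Prime] {k : ℕ} (h : GLInf p k) :
    ∃ θ : ℕ → GLInf p k, (∀ j, ∃ u, IsOrth p u ∧ (θ j).1 = Jembed p k u) ∧
      ∀ g : GLInf p k, ∀ᶠ j in Filter.atTop, Commute g (θ j * h * (θ j)⁻¹) := by
  obtain ⟨N, hN⟩ := h.2.exists_trivialOff_lt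
  let e : ℕ → Fin k × ℕ → Fin k × ℕ := fun j x => (x.1, blockSwap N (N + j) x.2)
  have he : ∀ j, Function.Involutive (e j) := fun j x =>
    Prod.ext rfl (blockSwap_involutive (Nat.le_add_right N j) x.2)
  have hfin : ∀ j, {x | e j x ≠ x}.Finite := fun j => by
    refine (Set.finite_univ.prod (blockSwap_support_finite N (N + j))).subset fun x hx => ?_
    exact ⟨trivial, fun h => hx (Prod.ext rfl h)⟩
  let θ : ℕ → GLInf p k := fun j => ⟨permMat p (e j), inGL_permMat (he j) (hfin j)⟩
  have hθinv : ∀ j, (θ j)⁻¹ = θ j := fun j =>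
    inv_eq_of_mul_eq_one_left (Subtype.ext (permMat_matMul_self (he j)))
  refine ⟨θ, fun j => ⟨permMat p (blockSwap N (N + j)),
    isOrth_permMat (blockSwap_involutive (Nat.le_add_right N j)) (blockSwap_support_finite _ _),
    (jembed_permMat p k _).symm⟩, fun g => ?_⟩
  obtain ⟨L, hL⟩ := g.2.exists_trivialOff_lt
  filter_upwards [Filter.eventually_ge_atTop L] with j hj
  rw [hθinv]
  have hconj : TrivialOff p {x | (e j x).2 < N} (θ j * h * θ j).1 := by
    intro x y hxy
    rw [GLInf.val_mul, GLInf.val_mul, matMul_permMat, permMat_matMul (he j), hN _ _ hxy]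
    simp only [idMat, (he j).injective.eq_iff]
  refine Subtype.ext (hL.matMul_comm hconj ?_)
  rw [Set.disjoint_left]
  intro x hx hx'
  simp only [Set.mem_ofPred_eq, e, blockSwap] at hx hx'
  split_ifs at hx' <;> omega

/-- Schur lemma for a normal operator commuting, together with its adjoint, with a
topologically irreducible set of operators. -/
theorem exists_eq_smul_one_of_forall_commute {E : Type*} [NormedAddCommGroup E]
    [InnerProductSpace ℂ E] [CompleteSpace E] (𝒜 : Set (E →L[ℂ] E))
    (hirr : ∀ W : Submodule ℂ E, IsClosed (W : Set E) → (∀ B ∈ 𝒜, ∀ v ∈ W, B v ∈ W) →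
      W = ⊥ ∨ W = ⊤)
    {A : E →L[ℂ] E} (hA : IsStarNormal A) (hcomm : ∀ B ∈ 𝒜, Commute A B)
    (hcomm' : ∀ B ∈ 𝒜, Commute (star A) B) : ∃ c : ℂ, A = c • 1 := by
  rcases subsingleton_or_nontrivial E with hE | hE
  · exact ⟨0, by ext v; exact Subsingleton.elim _ _⟩
  obtain ⟨z, hz⟩ := spectrum.nonempty A
  refine ⟨z, ?_⟩
  have hsub : ∀ y ∈ spectrum ℂ A, y = z := by
    intro y hy
    by_contra hyz
    have hpos : 0 < dist y z := dist_pos.2 hyz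
    let bump : ℂ → ℂ → ℂ := fun a x => ((max 0 (dist y z / 2 - dist x a) : ℝ) : ℂ)
    have hcont : ∀ a, Continuous (bump a) := fun a => by fun_prop
    have hself : ∀ a, bump a a ≠ 0 := by
      intro a
      simp only [bump, dist_self, sub_zero, ne_eq, Complex.ofReal_eq_zero]
      exact (lt_max_of_lt_right (by positivity)).ne'
    have hne : ∀ a ∈ spectrum ℂ A, cfc (bump a) A ≠ 0 := by
      intro a ha h0
      have h1 : cfc (bump a) A = cfc (fun _ : ℂ => (0 : ℂ)) A := by
        rw [h0, cfc_const_zero]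
      exact hself a ((cfc_eq_cfc_iff_eqOn (hf := (hcont a).continuousOn)).1 h1 ha)
    have hprod : cfc (bump y) A * cfc (bump z) A = 0 := by
      rw [← cfc_mul (bump y) (bump z) A (hcont y).continuousOn (hcont z).continuousOn,
        ← cfc_const_zero ℂ A]
      congr 1
      funext x
      simp only [bump, ← Complex.ofReal_mul, Complex.ofReal_eq_zero, mul_eq_zero]
      by_contra! hcon
      have h1 : 0 < dist y z / 2 - dist x y := by
        by_contra! h
        exact hcon.1 (max_eq_left h)
      have h2 : 0 < dist y z / 2 - dist x z := by
        by_contra! h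
        exact hcon.2 (max_eq_left h)
      have h3 := dist_triangle_left y z x
      linarith
    have hker := hirr (LinearMap.ker (cfc (bump y) A).toLinearMap)
      (cfc (bump y) A).isClosed_ker (by
        intro B hB v hv
        have hc := (hcomm B hB).cfc (hcomm' B hB) (bump y)
        have hc' := congrArg (fun T : E →L[ℂ] E => T v) hc.eq
        simp only [mul_apply_eq_comp] at hc'
        simp only [LinearMap.mem_ker, ContinuousLinearMap.coe_coe] at hv ⊢
        rw [hc', hv, map_zero])
    rcases hker with hker | hker
    · refine hne z hz ?_
      ext v
      have : cfc (bump z) A v ∈ LinearMap.ker (cfc (bump y) A).toLinearMap :=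
        congrArg (fun T : E →L[ℂ] E => T v) hprod
      rw [hker] at this
      simpa using this
    · refine hne y hy ?_
      ext v
      have : v ∈ LinearMap.ker (cfc (bump y) A).toLinearMap := by rw [hker]; trivial
      simpa using this
  calc A = cfc (fun x : ℂ => x) A := (cfc_id' ℂ A).symm
    _ = cfc (fun _ : ℂ => z) A := cfc_congr fun y hy => hsub y hy
    _ = z • 1 := by rw [cfc_const z A, Algebra.algebraMap_eq_smul_one]

/-- A commuting, star-closed, topologically irreducible set of operators acts on a space of
dimension at most one. -/
theorem exists_forall_eq_smul_of_commute {E : Type*} [NormedAddCommGroup E]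
    [InnerProductSpace ℂ E] [CompleteSpace E] (𝒜 : Set (E →L[ℂ] E))
    (hstar : ∀ A ∈ 𝒜, star A ∈ 𝒜) (hcomm : ∀ A ∈ 𝒜, ∀ B ∈ 𝒜, Commute A B)
    (hirr : ∀ W : Submodule ℂ E, IsClosed (W : Set E) → (∀ B ∈ 𝒜, ∀ v ∈ W, B v ∈ W) →
      W = ⊥ ∨ W = ⊤) :
    ∃ v₀ : E, ∀ v : E, ∃ c : ℂ, v = c • v₀ := by
  rcases subsingleton_or_nontrivial E with hE | hE
  · exact ⟨0, fun v => ⟨0, Subsingleton.elim _ _⟩⟩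
  obtain ⟨v₀, hv₀⟩ := exists_ne (0 : E)
  refine ⟨v₀, fun v => ?_⟩
  have hspan := hirr (ℂ ∙ v₀) (Submodule.closed_of_finiteDimensional _) (by
    intro B hB w hw
    obtain ⟨c, rfl⟩ := exists_eq_smul_one_of_forall_commute 𝒜 hirr
      ⟨hcomm _ (hstar B hB) _ hB⟩ (hcomm B hB) (hcomm _ (hstar B hB))
    exact Submodule.smul_mem _ c hw)
  rcases hspan with h | h
  · exact absurd (Submodule.span_singleton_eq_bot.1 h) hv₀
  · have : v ∈ ℂ ∙ v₀ := by rw [h]; trivial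
    obtain ⟨c, hc⟩ := Submodule.mem_span_singleton.1 this
    exact ⟨c, hc.symm⟩

section Representation

open Filter Topology

variable {G H : Type*} [Group G] [NormedAddCommGroup H] [InnerProductSpace ℂ H]

/-- The subspace of vectors fixed by all `ρ σ`, `σ ∈ K`. -/
def fixedVectors (ρ : G →* (H →L[ℂ] H)) (K : Set G) : Submodule ℂ H where
  carrier := {v | ∀ σ ∈ K, ρ σ v = v}
  zero_mem' := fun _ _ => map_zero _
  add_mem' := fun ha hb σ hσ => by rw [map_add, ha σ hσ, hb σ hσ]
  smul_mem' := fun c _ ha σ hσ => by rw [map_smul, ha σ hσ]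

theorem isClosed_fixedVectors (ρ : G →* (H →L[ℂ] H)) (K : Set G) :
    IsClosed (fixedVectors ρ K : Set H) := by
  have : (fixedVectors ρ K : Set H) = ⋂ σ ∈ K, {v | ρ σ v = v} := by
    ext v
    simp [fixedVectors]
  rw [this]
  exact isClosed_biInter fun σ _ => isClosed_eq (ρ σ).continuous continuous_id

theorem map_inv_map_apply (ρ : G →* (H →L[ℂ] H)) (g : G) (v : H) : ρ g⁻¹ (ρ g v) = v := by
  rw [← mul_apply_eq_comp, ← map_mul, inv_mul_cancel, map_one, one_apply_eq_self]

theorem norm_map_apply_of_inner {ρ : G →* (H →L[ℂ] H)}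
    (hρ : ∀ g x y, inner ℂ (ρ g x) y = inner ℂ x (ρ g⁻¹ y)) (g : G) (v : H) :
    ‖ρ g v‖ = ‖v‖ := by
  have h : inner ℂ (ρ g v) (ρ g v) = inner ℂ v v := by rw [hρ, map_inv_map_apply]
  rw [inner_self_eq_norm_sq_to_K, inner_self_eq_norm_sq_to_K] at h
  exact (sq_eq_sq₀ (norm_nonneg _) (norm_nonneg _)).1 (by exact_mod_cast h)

/-- A bounded sequence orthogonal to the `K`-fixed vectors, each element of `K` fixing almost
all of its terms, converges weakly to zero. -/
theorem tendsto_inner_zero_of_eventually_fixed [CompleteSpace H] {ρ : G →* (H →L[ℂ] H)}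
    (hρ : ∀ g x y, inner ℂ (ρ g x) y = inner ℂ x (ρ g⁻¹ y)) {K : Set G} {z : ℕ → H} {C : ℝ}
    (hz : ∀ j, ‖z j‖ ≤ C) (hfix : ∀ σ ∈ K, ∀ᶠ j in atTop, ρ σ (z j) = z j)
    (horth : ∀ w ∈ fixedVectors ρ K, ∀ j, inner ℂ (z j) w = 0) (w : H) :
    Tendsto (fun j => inner ℂ (z j) w) atTop (𝓝 0) := by
  let S : Submodule ℂ H :=
    { carrier := {w | Tendsto (fun j => inner ℂ (z j) w) atTop (𝓝 0)}
      zero_mem' := by simp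
      add_mem' := fun {a b} ha hb => by
        have := Tendsto.add ha hb
        simpa [inner_add_right] using this
      smul_mem' := fun c a ha => by
        have := Tendsto.const_mul c ha
        simpa [inner_smul_right] using this }
  have hSclosed : IsClosed (S : Set H) := by
    refine isClosed_of_closure_subset fun a ha => ?_
    refine Metric.tendsto_atTop.2 fun ε hε => ?_
    have hC : 0 ≤ C := (norm_nonneg _).trans (hz 0)
    obtain ⟨b, hb, hab⟩ := Metric.mem_closure_iff.1 ha (ε / (2 * (C + 1))) (by positivity)
    obtain ⟨N, hN⟩ := Metric.tendsto_atTop.1 hb (ε / 2) (by positivity)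
    refine ⟨N, fun n hn => ?_⟩
    have h1 := hN n hn
    rw [dist_zero_right] at h1 ⊢
    have h2 : ‖inner ℂ (z n) (a - b)‖ ≤ C * (ε / (2 * (C + 1))) := by
      refine (norm_inner_le_norm _ _).trans ?_
      rw [dist_eq_norm] at hab
      exact mul_le_mul (hz n) hab.le (norm_nonneg _) hC
    have h3 : C * (ε / (2 * (C + 1))) ≤ ε / 2 := by
      rw [mul_div_assoc', div_le_div_iff₀ (by positivity) (by positivity)]
      nlinarith
    have h4 : inner ℂ (z n) a = inner ℂ (z n) (a - b) + inner ℂ (z n) b := by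
      rw [← inner_add_right, sub_add_cancel]
    rw [h4]
    exact (norm_add_le _ _).trans_lt (by linarith)
  have hle : fixedVectors ρ K ≤ S := fun w hw => by
    change Tendsto _ _ _
    simp [horth w hw]
  have hcob : ∀ σ ∈ K, ∀ u, ρ σ⁻¹ u - u ∈ S := fun σ hσ u => by
    change Tendsto _ _ _
    refine tendsto_const_nhds.congr' ?_
    filter_upwards [hfix σ hσ] with j hj
    rw [inner_sub_right, ← hρ, hj, sub_self]
  have : CompleteSpace S := hSclosed.completeSpace_coe
  have htop : S = ⊤ := by
    rw [← Submodule.orthogonal_eq_bot_iff, Submodule.eq_bot_iff]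
    intro y hy
    have hyfix : y ∈ fixedVectors ρ K := fun σ hσ => by
      rw [← sub_eq_zero]
      refine ext_inner_right ℂ fun u => ?_
      rw [inner_sub_left, hρ, ← inner_sub_right, inner_zero_left]
      exact Submodule.inner_left_of_mem_orthogonal (hcob σ hσ u) hy
    exact inner_self_eq_zero.1 (Submodule.inner_right_of_mem_orthogonal (hle hyfix) hy)
  have : w ∈ S := htop ▸ Submodule.mem_top
  exact this

theorem tendsto_inner_starProjection_fixedVectors [CompleteSpace H] {ρ : G →* (H →L[ℂ] H)}
    (hρ : ∀ g x y, inner ℂ (ρ g x) y = inner ℂ x (ρ g⁻¹ y)) {K : Set G}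
    [(fixedVectors ρ K).HasOrthogonalProjection] {θ : ℕ → G} (hθ : ∀ j, θ j ∈ K) {h : G}
    (hcomm : ∀ g : G, ∀ᶠ j in atTop, Commute g (θ j * h * (θ j)⁻¹)) {v : H}
    (hv : v ∈ fixedVectors ρ K) (w : H) :
    Tendsto (fun j => inner ℂ (ρ (θ j * h * (θ j)⁻¹) v) w) atTop
      (𝓝 (inner ℂ ((fixedVectors ρ K).starProjection (ρ h v)) w)) := by
  have inv_fix : ∀ {w}, w ∈ fixedVectors ρ K → ∀ σ ∈ K, ρ σ⁻¹ w = w := fun {w} hw σ hσ => by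
    conv_lhs => rw [← hw σ hσ, map_inv_map_apply]
  set y := (fixedVectors ρ K).starProjection (ρ h v) with hy
  have hyE : y ∈ fixedVectors ρ K := Submodule.starProjection_apply_mem _ _
  have hlim := tendsto_inner_zero_of_eventually_fixed hρ (K := K)
    (z := fun j => ρ (θ j * h * (θ j)⁻¹) v - y) (C := ‖v‖ + ‖y‖) (fun j => by
      refine (norm_sub_le _ _).trans ?_
      rw [norm_map_apply_of_inner hρ]) (fun σ hσ => by
      filter_upwards [hcomm σ] with j hj
      rw [map_sub, hyE σ hσ, ← mul_apply_eq_comp, ← map_mul, hj.eq, map_mul, mul_apply_eq_comp,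
        hv σ hσ]) (fun w hw j => by
      have h1 : inner ℂ (ρ (θ j * h * (θ j)⁻¹) v) w = inner ℂ (ρ h v) w := by
        rw [map_mul, map_mul, mul_apply_eq_comp, mul_apply_eq_comp, inv_fix hv _ (hθ j), hρ,
          inv_fix hw _ (hθ j)]
      rw [inner_sub_left, h1, hy, Submodule.inner_starProjection_left_eq_right,
        Submodule.starProjection_eq_self_iff.2 hw, sub_self]) w
  have := hlim.add_const (inner ℂ y w)
  simpa [inner_sub_left] using this

/-- An irreducible unitary representation of a group in which every element can be conjugated by
`K` so as to commute asymptotically with everything has at most one `K`-fixed line. -/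
theorem exists_fixedVectors_eq_smul [CompleteSpace H] {ρ : G →* (H →L[ℂ] H)}
    (hρ : ∀ g x y, inner ℂ (ρ g x) y = inner ℂ x (ρ g⁻¹ y)) {K : Set G}
    (hK : ∀ h : G, ∃ θ : ℕ → G, (∀ j, θ j ∈ K) ∧
      ∀ g : G, ∀ᶠ j in atTop, Commute g (θ j * h * (θ j)⁻¹))
    (hirr : ∀ S : Submodule ℂ H, IsClosed (S : Set H) → (∀ g, ∀ v ∈ S, ρ g v ∈ S) →
      S = ⊥ ∨ S = ⊤) :
    ∃ v₀ : H, ∀ v ∈ fixedVectors ρ K, ∃ c : ℂ, v = c • v₀ := by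
  set E := fixedVectors ρ K
  have : CompleteSpace E := (isClosed_fixedVectors ρ K).completeSpace_coe
  let T : G → E →L[ℂ] E := fun g => E.orthogonalProjectionOnto ∘L ρ g ∘L E.subtypeL
  have hT : ∀ g (v w : E), inner ℂ (T g v) w = inner ℂ (ρ g (v : H)) (w : H) := fun g v w => by
    simp [T]
  have hTinv : ∀ g (v w : E), inner ℂ (T g v) w = inner ℂ v (T g⁻¹ w) := fun g v w => by
    simp [T, hρ]
  have hTcoe : ∀ g (v : E), ((T g v : E) : H) = E.starProjection (ρ g (v : H)) := fun _ _ => rfl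
  have hstar : ∀ g, star (T g) = T g⁻¹ := fun g => by
    rw [ContinuousLinearMap.star_eq_adjoint]
    refine ((ContinuousLinearMap.eq_adjoint_iff _ _).2 fun x y => ?_).symm
    rw [hTinv, inv_inv]
  have hcomm : ∀ g h, Commute (T g) (T h) := by
    intro g h
    ext1 v
    refine ext_inner_right ℂ fun w => ?_
    rw [mul_apply_eq_comp, mul_apply_eq_comp]
    obtain ⟨θ, hθK, hθ⟩ := hK h
    have hθ' : ∀ g : G, ∀ᶠ j in atTop, Commute g (θ j * h⁻¹ * (θ j)⁻¹) := fun g =>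
      (hθ g).mono fun j hj => by
        have := hj.inv_right
        simpa [mul_assoc] using this
    have h1 := tendsto_inner_starProjection_fixedVectors hρ hθK hθ v.2 (ρ g⁻¹ (w : H))
    have h2 := tendsto_inner_starProjection_fixedVectors hρ hθK hθ' w.2 (ρ g (v : H))
    have h2' := (Complex.continuous_conj.tendsto _).comp h2
    have heq : ∀ᶠ j in atTop, inner ℂ (ρ (θ j * h * (θ j)⁻¹) (v : H)) (ρ g⁻¹ (w : H)) =
        (starRingEnd ℂ) (inner ℂ (ρ (θ j * h⁻¹ * (θ j)⁻¹) (w : H)) (ρ g (v : H))) := by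
      filter_upwards [hθ g] with j hj
      have hinv : θ j * h⁻¹ * (θ j)⁻¹ = (θ j * h * (θ j)⁻¹)⁻¹ := by simp [mul_assoc]
      rw [inner_conj_symm, hinv, ← hρ, ← hρ, ← mul_apply_eq_comp, ← mul_apply_eq_comp, ← map_mul,
        ← map_mul, hj.eq]
    have hlim := tendsto_nhds_unique (h1.congr' heq) h2'
    rw [hT, hTcoe, hρ, hlim, inner_conj_symm, hTinv, ← hTcoe, ← hT]
  have hTirr : ∀ W : Submodule ℂ E, IsClosed (W : Set E) →
      (∀ B ∈ Set.range T, ∀ v ∈ W, B v ∈ W) → W = ⊥ ∨ W = ⊤ := by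
    intro W hW hinv
    let S : Submodule ℂ H := ⨅ g, W.comap (E.orthogonalProjectionOnto ∘L ρ g).toLinearMap
    have hS : ∀ x, x ∈ S ↔ ∀ g, E.orthogonalProjectionOnto (ρ g x) ∈ W := fun x => by simp [S]
    have hSclosed : IsClosed (S : Set H) := by
      have : (S : Set H) = ⋂ g, (E.orthogonalProjectionOnto ∘L ρ g) ⁻¹' (W : Set E) := by
        ext x
        simp [hS]
      rw [this]
      exact isClosed_iInter fun g => hW.preimage (ContinuousLinearMap.continuous _)
    have hmem : ∀ v ∈ W, (v : H) ∈ S := fun v hv => (hS _).2 fun g => hinv _ ⟨g, rfl⟩ v hv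
    rcases hirr S hSclosed (fun g v hv => (hS _).2 fun g' => by
      rw [← mul_apply_eq_comp, ← map_mul]
      exact (hS v).1 hv (g' * g)) with h | h
    · left
      rw [Submodule.eq_bot_iff]
      intro v hv
      have := hmem v hv
      rw [h, Submodule.mem_bot] at this
      exact_mod_cast this
    · right
      rw [Submodule.eq_top_iff']
      intro v
      have := (hS v).1 (h ▸ Submodule.mem_top) 1
      simpa using this
  obtain ⟨v₀, hv₀⟩ := exists_forall_eq_smul_of_commute (Set.range T)
    (by rintro _ ⟨g, rfl⟩; exact ⟨g⁻¹, (hstar g).symm⟩)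
    (by rintro _ ⟨g, rfl⟩ _ ⟨h, rfl⟩; exact hcomm g h) hTirr
  refine ⟨v₀, fun v hv => ?_⟩
  obtain ⟨c, hc⟩ := hv₀ ⟨v, hv⟩
  exact ⟨c, congrArg Subtype.val hc⟩

end Representation

/-- **Sphericity of the pair `(G, K)`.** For `G = GL(k∞, ℚ_p)` and `K = 𝔍(O(∞, ℤ_p))`, every
irreducible unitary representation of `G` has at most a one-dimensional space of `K`-fixed
vectors: all `K`-fixed vectors are multiples of a single vector `v₀`. -/
theorem sphericity (p : ℕ) [Fact p.Prime] (k : ℕ) (hk : 1 ≤ k)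
    {𝓗 : Type*} [NormedAddCommGroup 𝓗] [InnerProductSpace ℂ 𝓗] [CompleteSpace 𝓗]
    (ρ : ((Fin k × ℕ) → (Fin k × ℕ) → ℚ_[p]) → (𝓗 →L[ℂ] 𝓗))
    (hρ_unitary : ∀ g, InGL p k g → ρ g ∈ unitary (𝓗 →L[ℂ] 𝓗))
    (hρ_one : ρ (idMat p) = 1)
    (hρ_mul : ∀ g h, InGL p k g → InGL p k h → ρ (matMul p g h) = ρ g * ρ h)
    (hirr : ∀ S : Submodule ℂ 𝓗, IsClosed (S : Set 𝓗) →
      (∀ g, InGL p k g → ∀ v ∈ S, ρ g v ∈ S) → S = ⊥ ∨ S = ⊤) :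
    ∃ v₀ : 𝓗, ∀ v : 𝓗,
      (∀ u : ℕ → ℕ → ℚ_[p], IsOrth p u → ρ (Jembed p k u) v = v) →
      ∃ c : ℂ, v = c • v₀ := by
  let ρ' : GLInf p k →* (𝓗 →L[ℂ] 𝓗) :=
    { toFun := fun g => ρ g.1
      map_one' := hρ_one
      map_mul' := fun g h => hρ_mul g.1 h.1 g.2 h.2 }
  have hρ' : ∀ g x y, inner ℂ (ρ' g x) y = inner ℂ x (ρ' g⁻¹ y) := by
    intro g x y
    have h1 : star (ρ' g) * ρ' g = 1 := (hρ_unitary g.1 g.2).1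
    have h2 : ρ' g * ρ' g⁻¹ = 1 := by rw [← map_mul, mul_inv_cancel, map_one]
    rw [← left_inv_eq_right_inv h1 h2, ContinuousLinearMap.star_eq_adjoint,
      ContinuousLinearMap.adjoint_inner_right]
  obtain ⟨v₀, hv₀⟩ := exists_fixedVectors_eq_smul hρ'
    (K := {g | ∃ u, IsOrth p u ∧ g.1 = Jembed p k u})
    GLInf.exists_asymptotically_commuting
    (fun S hS hinv => hirr S hS fun g hg => hinv ⟨g, hg⟩)
  refine ⟨v₀, fun v hv => hv₀ v ?_⟩
  rintro g ⟨u, hu, hgu⟩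
  change ρ g.1 v = v
  rw [hgu]
  exact hv u hu
end

section
/- Double-coset invariance of the characteristic function: for h, h' ∈ O(m, ℤ_p) (m×m matrices over ℤ_p with hᵗh = 1), let 𝔍_m(h) = diag(1_α, h, …, h) ∈ GL(α+km, ℚ_p) (the block-diagonal matrix with the identity on the α coordinates and h on each of the k blocks of size m). Then for every g ∈ GL(α+km, ℚ_p) and all ℤ_p-submodules Q, T ⊆ H: χ_{𝔍_m(h)·g·𝔍_m(h')}(Q,T) = χ_g(Q,T). -/
open scoped BigOperators

/-- The symplectic coordinate space `ℚ_p^n ⊕ ℚ_p^n`, written as pairs `(x⁺, x⁻)`. -/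
abbrev SpV (p : ℕ) [Fact p.Prime] (n : ℕ) := (Fin n → ℚ_[p]) × (Fin n → ℚ_[p])

/-- The standard skew-symmetric bilinear form `B(x, y) = Σ_s (x_s⁺ y_s⁻ − x_s⁻ y_s⁺)`. -/
noncomputable def Bform (p : ℕ) [Fact p.Prime] (n : ℕ) (x y : SpV p n) : ℚ_[p] :=
  ∑ s, (x.1 s * y.2 s - x.2 s * y.1 s)

/-- The form `B^⊖(u ⊕ v, u' ⊕ v') = B_V(u, u') − B_V(v, v')` on `V ⊕ V`. -/
noncomputable def Bminus (p : ℕ) [Fact p.Prime] (α : ℕ) (z w : SpV p α × SpV p α) : ℚ_[p] :=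
  Bform p α z.1 w.1 - Bform p α z.2 w.2

/-- The dual module `P^⊥⊥ = {w : B(v,w) ∈ ℤ_p for all v ∈ P}` of a set `P` with respect to a
bilinear form `B` (membership in `ℤ_p` expressed as `‖·‖ ≤ 1`). -/
def dualMod (p : ℕ) [Fact p.Prime] {X : Type*} (B : X → X → ℚ_[p]) (P : Set X) : Set X :=
  {w | ∀ v ∈ P, ‖B v w‖ ≤ 1}

/-- A set is *self-dual* with respect to `B` if it coincides with its dual module. -/
def IsSelfDual (p : ℕ) [Fact p.Prime] {X : Type*} (B : X → X → ℚ_[p]) (P : Set X) : Prop :=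
  dualMod p B P = P

/-- A `ℤ_p`-submodule of a `ℚ_p`-vector space: a set containing `0`, closed under addition
and under multiplication by p-adic integers (scalars of norm at most 1). -/
def IsZpSubmodule (p : ℕ) [Fact p.Prime] {X : Type*} [AddCommGroup X] [Module ℚ_[p] X]
    (P : Set X) : Prop :=
  (0 : X) ∈ P ∧ (∀ x ∈ P, ∀ y ∈ P, x + y ∈ P) ∧
    ∀ c : ℚ_[p], ‖c‖ ≤ 1 → ∀ x ∈ P, c • x ∈ P

/-- The index set `{1,…,α} ⊔ ({1,…,k} × {1,…,m})` for matrices in `GL(α + km, ℚ_p)`. -/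
abbrev BigIx (α k m : ℕ) := Fin α ⊕ (Fin k × Fin m)

/-- Glue a vector `u ∈ ℚ_p^α` and a tuple `x = (x_1, …, x_k)` with `x_j ∈ ℚ_p^m` into a single
vector indexed by `BigIx α k m`. -/
def glue {p α k m : ℕ} [Fact p.Prime] (u : Fin α → ℚ_[p]) (x : Fin k → Fin m → ℚ_[p]) :
    BigIx α k m → ℚ_[p] :=
  Sum.elim u fun js => x js.1 js.2

/-- The slice of a tuple `x = (x⁺, x⁻)` (with `x_j^± ∈ ℚ_p^m`) at coordinate `s`, as an
element of `H = ℚ_p^k ⊕ ℚ_p^k`. -/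
def tupleSlice {p k m : ℕ} [Fact p.Prime]
    (xp xm : Fin k → Fin m → ℚ_[p]) (s : Fin m) : SpV p k :=
  (fun j => xp j s, fun j => xm j s)

/-- **The characteristic function** `χ_g(Q, T)` of `g ∈ GL(α + km, ℚ_p)` (viewed as a matrix
`M` on the index set `BigIx α k m`): the set of all `(u⁺ ⊕ u⁻) ⊕ (v⁺ ⊕ v⁻) ∈ V ⊕ V` for which
there exist `x ∈ Q ⊗ ℤ_p^m` and `y ∈ T ⊗ ℤ_p^m` with `(v⁺, y⁺) = g (u⁺, x⁺)` and
`(u⁻, x⁻) = gᵗ (v⁻, y⁻)`. -/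
def chiM (p α k m : ℕ) [Fact p.Prime]
    (M : Matrix (BigIx α k m) (BigIx α k m) ℚ_[p]) (Q T : Set (SpV p k)) :
    Set (SpV p α × SpV p α) :=
  {uv | ∃ xp xm yp ym : Fin k → Fin m → ℚ_[p],
    (∀ s : Fin m, tupleSlice xp xm s ∈ Q) ∧
    (∀ s : Fin m, tupleSlice yp ym s ∈ T) ∧
    glue uv.2.1 yp = M.mulVec (glue uv.1.1 xp) ∧
    glue uv.1.2 xm = M.transpose.mulVec (glue uv.2.2 ym)}

/-- The block-diagonal embedding `𝔍_m(h) = diag(1_α, h, …, h) ∈ GL(α + km, ℚ_p)` of an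
`m × m` matrix `h`, with `h` repeated on each of the `k` blocks of size `m`. -/
noncomputable def JmatM (p α k m : ℕ) [Fact p.Prime] (h : Matrix (Fin m) (Fin m) ℚ_[p]) :
    Matrix (BigIx α k m) (BigIx α k m) ℚ_[p] :=
  fun i j =>
    match i, j with
    | Sum.inl r, Sum.inl r' => if r = r' then 1 else 0
    | Sum.inr is, Sum.inr jt => if is.1 = jt.1 then h is.2 jt.2 else 0
    | _, _ => 0

/-- Membership in `O(m, ℤ_p)`: an `m × m` matrix over `ℚ_p` with entries in `ℤ_p`
(norm at most 1) satisfying `hᵗ h = 1`. -/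
def IsOrthMat (p m : ℕ) [Fact p.Prime] (h : Matrix (Fin m) (Fin m) ℚ_[p]) : Prop :=
  (∀ s t, ‖h s t‖ ≤ 1) ∧ h.transpose * h = 1

theorem JmatM_mulVec_glue {p α k m : ℕ} [Fact p.Prime] (h : Matrix (Fin m) (Fin m) ℚ_[p])
    (u : Fin α → ℚ_[p]) (x : Fin k → Fin m → ℚ_[p]) :
    (JmatM p α k m h).mulVec (glue u x) = glue u fun j => h.mulVec (x j) := by
  funext i
  rcases i with r | ⟨i, s⟩
  · simp [Matrix.mulVec, dotProduct, JmatM, glue]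
  · simp [Matrix.mulVec, dotProduct, JmatM, glue, Fintype.sum_prod_type, Finset.sum_ite_irrel]

theorem JmatM_transpose {p α k m : ℕ} [Fact p.Prime] (h : Matrix (Fin m) (Fin m) ℚ_[p]) :
    (JmatM p α k m h).transpose = JmatM p α k m h.transpose := by
  ext (r | ⟨i, s⟩) (r' | ⟨j, t⟩) <;> simp [JmatM, eq_comm]

theorem JmatM_mul_JmatM {p α k m : ℕ} [Fact p.Prime] (h h' : Matrix (Fin m) (Fin m) ℚ_[p]) :
    JmatM p α k m h * JmatM p α k m h' = JmatM p α k m (h * h') := by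
  ext (r | ⟨i, s⟩) (r' | ⟨j, t⟩) <;>
    simp [JmatM, Matrix.mul_apply, Fintype.sum_prod_type, Finset.sum_ite_irrel]

theorem JmatM_one {p α k m : ℕ} [Fact p.Prime] :
    JmatM p α k m 1 = 1 := by
  ext (r | ⟨i, s⟩) (r' | ⟨j, t⟩) <;>
    simp [JmatM, Matrix.one_apply, ite_and]

theorem IsOrthMat.mul_transpose {p m : ℕ} [Fact p.Prime] {h : Matrix (Fin m) (Fin m) ℚ_[p]}
    (hh : IsOrthMat p m h) : h * h.transpose = 1 :=
  mul_eq_one_comm.mp hh.2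

theorem IsOrthMat.transpose {p m : ℕ} [Fact p.Prime] {h : Matrix (Fin m) (Fin m) ℚ_[p]}
    (hh : IsOrthMat p m h) : IsOrthMat p m h.transpose :=
  ⟨fun s t => hh.1 t s, by simpa using hh.mul_transpose⟩

theorem IsZpSubmodule.sum_mem {p : ℕ} [Fact p.Prime] {X : Type*} [AddCommGroup X]
    [Module ℚ_[p] X] {P : Set X} (hP : IsZpSubmodule p P) {ι : Type*} (s : Finset ι)
    {f : ι → X} (hf : ∀ i ∈ s, f i ∈ P) : ∑ i ∈ s, f i ∈ P :=
  Finset.sum_induction f (· ∈ P) (fun x y hx hy => hP.2.1 x hx y hy) hP.1 hf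

/-- Integral matrices acting on the `ℤ_p^m` factor preserve `Q ⊗ ℤ_p^m`. -/
theorem IsZpSubmodule.tupleSlice_mulVec_mem {p k m : ℕ} [Fact p.Prime] {Q : Set (SpV p k)}
    (hQ : IsZpSubmodule p Q) {h : Matrix (Fin m) (Fin m) ℚ_[p]} (hh : ∀ s t, ‖h s t‖ ≤ 1)
    {xp xm : Fin k → Fin m → ℚ_[p]} (hx : ∀ s, tupleSlice xp xm s ∈ Q) (s : Fin m) :
    tupleSlice (fun j => h.mulVec (xp j)) (fun j => h.mulVec (xm j)) s ∈ Q := by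
  have key : tupleSlice (fun j => h.mulVec (xp j)) (fun j => h.mulVec (xm j)) s =
      ∑ t, h s t • tupleSlice xp xm t := by
    ext j <;> simp [tupleSlice, Matrix.mulVec, dotProduct, Prod.fst_sum, Prod.snd_sum]
  rw [key]
  exact hQ.sum_mem _ fun t _ => hQ.2.2 _ (hh s t) _ (hx t)

theorem chiM_JmatM_mul_mul_JmatM_subset {p α k m : ℕ} [Fact p.Prime]
    (M : Matrix (BigIx α k m) (BigIx α k m) ℚ_[p])
    {h h' : Matrix (Fin m) (Fin m) ℚ_[p]} (hh : IsOrthMat p m h) (hh' : IsOrthMat p m h')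
    {Q T : Set (SpV p k)} (hQ : IsZpSubmodule p Q) (hT : IsZpSubmodule p T) :
    chiM p α k m (JmatM p α k m h * M * JmatM p α k m h') Q T ⊆ chiM p α k m M Q T := by
  rintro uv ⟨xp, xm, yp, ym, hx, hy, hplus, hminus⟩
  refine ⟨_, _, _, _, hQ.tupleSlice_mulVec_mem hh'.1 hx,
    hT.tupleSlice_mulVec_mem hh.transpose.1 hy, ?_, ?_⟩
  · rw [← JmatM_mulVec_glue, ← JmatM_mulVec_glue, hplus, Matrix.mulVec_mulVec,
      Matrix.mulVec_mulVec, ← mul_assoc, ← mul_assoc, JmatM_mul_JmatM, hh.2, JmatM_one, one_mul]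
  · rw [← JmatM_mulVec_glue, ← JmatM_mulVec_glue, hminus, Matrix.mulVec_mulVec,
      Matrix.mulVec_mulVec, Matrix.transpose_mul, Matrix.transpose_mul, JmatM_transpose,
      JmatM_transpose, ← mul_assoc, JmatM_mul_JmatM, hh'.mul_transpose, JmatM_one, one_mul]

/-- **Double-coset invariance of the characteristic function:** for `h, h' ∈ O(m, ℤ_p)`,
`g ∈ GL(α + km, ℚ_p)` and all `ℤ_p`-submodules `Q, T ⊆ H`, one has
`χ_{𝔍_m(h) g 𝔍_m(h')}(Q, T) = χ_g(Q, T)`. -/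
theorem chi_double_coset_invariance (p : ℕ) [Fact p.Prime] (α k m : ℕ)
    (hk : 1 ≤ k) (hm : 1 ≤ m)
    (M : Matrix (BigIx α k m) (BigIx α k m) ℚ_[p]) (hM : IsUnit M)
    (h h' : Matrix (Fin m) (Fin m) ℚ_[p]) (hh : IsOrthMat p m h) (hh' : IsOrthMat p m h')
    (Q T : Set (SpV p k)) (hQ : IsZpSubmodule p Q) (hT : IsZpSubmodule p T) :
    chiM p α k m (JmatM p α k m h * M * JmatM p α k m h') Q T = chiM p α k m M Q T := by
  refine (chiM_JmatM_mul_mul_JmatM_subset M hh hh' hQ hT).antisymm ?_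
  have key : JmatM p α k m h.transpose * (JmatM p α k m h * M * JmatM p α k m h') *
      JmatM p α k m h'.transpose = M := by
    rw [mul_assoc (JmatM p α k m h), ← mul_assoc, JmatM_mul_JmatM, hh.2, JmatM_one, one_mul,
      mul_assoc, JmatM_mul_JmatM, hh'.mul_transpose, JmatM_one, mul_one]
  conv_lhs => rw [← key]
  exact chiM_JmatM_mul_mul_JmatM_subset _ hh.transpose hh'.transpose hQ hT
end

section
/- Self-duality of values of the characteristic function: if Q, T ⊆ H are self-dual ℤ_p-submodules (Q = Q^⊥⊥ and T = T^⊥⊥ with respect to B_H), then for every g ∈ GL(α+km, ℚ_p) the submodule χ_g(Q,T) ⊆ V⊕V is self-dual with respect to the form B^⊖ on V⊕V. -/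
open scoped BigOperators

open scoped Matrix

section Separation

variable {p : ℕ} [Fact p.Prime] {W : Type*} [AddCommGroup W] [Module ℚ_[p] W]

lemma IsZpSubmodule.sub_smul_mem {P : Set W} (hP : IsZpSubmodule p P) {x y : W} (hx : x ∈ P)
    (hy : y ∈ P) {r : ℚ_[p]} (hr : ‖r‖ ≤ 1) : y - r • x ∈ P := by
  rw [sub_eq_add_neg, ← neg_smul]
  exact hP.2.1 _ hy _ (hP.2.2 _ (by rwa [norm_neg]) _ hx)

lemma Padic.norm_add_le_one {x y : ℚ_[p]} (hx : ‖x‖ ≤ 1) (hy : ‖y‖ ≤ 1) : ‖x + y‖ ≤ 1 :=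
  (IsUltrametricDist.norm_add_le_max x y).trans (max_le hx hy)

lemma Padic.norm_sum_le_one {ι : Type*} {s : Finset ι} {f : ι → ℚ_[p]}
    (h : ∀ i ∈ s, ‖f i‖ ≤ 1) : ‖∑ i ∈ s, f i‖ ≤ 1 :=
  Finset.sum_induction f (fun x => ‖x‖ ≤ 1) (fun _ _ => Padic.norm_add_le_one) (by simp) h

/-- A functional integral on `P ∩ ker φ ∩ U` becomes integral on `P ∩ U` after adding a suitable
multiple of `φ`. -/
lemma exists_integral_add_mul {P : Set W} (hP : IsZpSubmodule p P) (U : Submodule ℚ_[p] W)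
    (f φ : W →ₗ[ℚ_[p]] ℚ_[p]) (hf : ∀ x ∈ P, x ∈ U → φ x = 0 → ‖f x‖ ≤ 1) :
    ∃ c : ℚ_[p], ∀ x ∈ P, x ∈ U → ‖f x + φ x * c‖ ≤ 1 := by
  let ι := {x : W // x ∈ P ∧ x ∈ U ∧ φ x ≠ 0}
  let t : ι → Set ℚ_[p] := fun x => {c | ‖f x.1 + φ x.1 * c‖ ≤ 1}
  have anti : ∀ x y : ι, ‖φ y.1‖ ≤ ‖φ x.1‖ → t x ⊆ t y := by
    rintro ⟨x, hxP, hxU, hx⟩ ⟨y, hyP, hyU, hy⟩ hxy c hc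
    change ‖φ y‖ ≤ ‖φ x‖ at hxy
    change ‖f x + φ x * c‖ ≤ 1 at hc
    change ‖f y + φ y * c‖ ≤ 1
    have hr : ‖φ y / φ x‖ ≤ 1 := by
      rw [norm_div]
      exact div_le_one_of_le₀ hxy (norm_nonneg _)
    have key := hf _ (hP.sub_smul_mem hxP hyP hr) (U.sub_mem hyU (U.smul_mem _ hxU))
      (by simp [hx])
    have split : f y + φ y * c = f (y - (φ y / φ x) • x) + φ y / φ x * (f x + φ x * c) := by
      simp only [map_sub, map_smul, smul_eq_mul]
      field_simp
      ring
    rw [split]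
    refine Padic.norm_add_le_one key ?_
    rw [norm_mul]
    exact mul_le_one₀ hr (norm_nonneg _) hc
  have closed : ∀ x, IsClosed (t x) := fun x =>
    isClosed_le (by fun_prop) continuous_const
  have compact : ∀ x, IsCompact (t x) := by
    intro x
    refine (isCompact_closedBall (-(f x.1) / φ x.1) ‖φ x.1‖⁻¹).of_isClosed_subset (closed x) ?_
    intro c hc
    have hx : φ x.1 ≠ 0 := x.2.2.2
    have hc' : ‖f x.1 + φ x.1 * c‖ ≤ 1 := hc
    have split : c - -(f x.1) / φ x.1 = (φ x.1)⁻¹ * (f x.1 + φ x.1 * c) := by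
      field_simp
      ring
    rw [Metric.mem_closedBall, dist_eq_norm, split, norm_mul, norm_inv]
    exact mul_le_of_le_one_right (by positivity) hc'
  have nonempty : ∀ x, (t x).Nonempty := by
    intro x
    have hx : φ x.1 ≠ 0 := x.2.2.2
    refine ⟨-(f x.1) / φ x.1, ?_⟩
    change ‖f x.1 + φ x.1 * (-(f x.1) / φ x.1)‖ ≤ 1
    rw [mul_div_cancel₀ _ hx]
    simp
  have directed : Directed (· ⊇ ·) t := by
    intro x y
    rcases le_total ‖φ y.1‖ ‖φ x.1‖ with h | h
    · exact ⟨x, subset_rfl, anti x y h⟩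
    · exact ⟨y, anti y x h, subset_rfl⟩
  obtain ⟨c, hc⟩ : ∃ c, ∀ x, c ∈ t x := by
    rcases isEmpty_or_nonempty ι with h | h
    · exact ⟨0, fun x => h.elim x⟩
    · obtain ⟨c, hc⟩ := IsCompact.nonempty_iInter_of_directed_nonempty_isCompact_isClosed
        t directed nonempty compact closed
      exact ⟨c, Set.mem_iInter.1 hc⟩
  refine ⟨c, fun x hxP hxU => ?_⟩
  by_cases hx : φ x = 0
  · simpa [hx] using hf x hxP hxU hx
  · exact hc ⟨x, hxP, hxU, hx⟩

lemma exists_integral_extension [FiniteDimensional ℚ_[p] W] {P : Set W}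
    (hP : IsZpSubmodule p P) (U : Submodule ℚ_[p] W) :
    ∀ f : W →ₗ[ℚ_[p]] ℚ_[p], (∀ x ∈ P, x ∈ U → ‖f x‖ ≤ 1) →
      ∃ f' : W →ₗ[ℚ_[p]] ℚ_[p], (∀ x ∈ U, f' x = f x) ∧ ∀ x ∈ P, ‖f' x‖ ≤ 1 := by
  induction U using IsNoetherian.induction with
  | hgt U ih =>
    intro f hf
    by_cases htop : U = ⊤
    · exact ⟨f, fun _ _ => rfl, fun x hx => hf x hx (htop ▸ Submodule.mem_top)⟩
    obtain ⟨v, -, hv⟩ := SetLike.exists_of_lt (lt_top_iff_ne_top.2 htop)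
    obtain ⟨φ, hφv, hφU⟩ := U.exists_le_ker_of_notMem hv
    have hker : ∀ x ∈ U ⊔ Submodule.span ℚ_[p] {v}, φ x = 0 → x ∈ U := by
      intro x hx hφx
      obtain ⟨u, hu, w, hw, rfl⟩ := Submodule.mem_sup.1 hx
      obtain ⟨a, rfl⟩ := Submodule.mem_span_singleton.1 hw
      have hφu : φ u = 0 := hφU hu
      have ha : a = 0 := by simpa [hφu, hφv] using hφx
      simpa [ha] using hu
    obtain ⟨c, hc⟩ := exists_integral_add_mul hP (U ⊔ Submodule.span ℚ_[p] {v}) f φ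
      fun x hxP hxU hx => hf x hxP (hker x hxU hx)
    have hlt : U < U ⊔ Submodule.span ℚ_[p] {v} :=
      left_lt_sup.2 fun h => hv (h (Submodule.mem_span_singleton_self v))
    obtain ⟨f', hf'U, hf'P⟩ := ih _ hlt (f + c • φ) fun x hxP hxU => by
      simpa [mul_comm] using hc x hxP hxU
    refine ⟨f', fun x hx => ?_, hf'P⟩
    have hφx : φ x = 0 := hφU hx
    simp [hf'U x (hlt.le hx), hφx]

/-- A `ℤ_p`-submodule of a finite-dimensional `ℚ_p`-space is separated from any point outside it
by a linear functional. -/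
lemma IsZpSubmodule.exists_separating_functional [FiniteDimensional ℚ_[p] W] {P : Set W}
    (hP : IsZpSubmodule p P) {w : W} (hw : w ∉ P) :
    ∃ f : W →ₗ[ℚ_[p]] ℚ_[p], (∀ x ∈ P, ‖f x‖ ≤ 1) ∧ 1 < ‖f w‖ := by
  have hp : (1 : ℝ) < p := by exact_mod_cast (Fact.out : p.Prime).one_lt
  have hw0 : w ≠ 0 := fun h => hw (h ▸ hP.1)
  obtain ⟨φ, hφ, -⟩ := (⊥ : Submodule ℚ_[p] W).exists_le_ker_of_notMem (v := w) (by simpa)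
  obtain ⟨f, hfU, hfP⟩ := exists_integral_extension hP (Submodule.span ℚ_[p] {w})
    (((p : ℚ_[p])⁻¹ * (φ w)⁻¹) • φ) (by
      intro x hxP hxU
      obtain ⟨a, rfl⟩ := Submodule.mem_span_singleton.1 hxU
      have ha : ‖a‖ < 1 := by
        by_contra! h
        have ha0 : a ≠ 0 := by
          rintro rfl
          norm_num at h
        refine hw ?_
        have := hP.2.2 a⁻¹ (by rw [norm_inv]; exact inv_le_one_of_one_le₀ h) _ hxP
        rwa [inv_smul_smul₀ ha0] at this
      have ha' : ‖a‖ ≤ (p : ℝ)⁻¹ := by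
        have := (Padic.norm_le_pow_iff_norm_lt_pow_add_one a (-1)).2 (by simpa using ha)
        simpa using this
      have heq : (((p : ℚ_[p])⁻¹ * (φ w)⁻¹) • φ) (a • w) = (p : ℚ_[p])⁻¹ * a := by
        simp only [LinearMap.smul_apply, map_smul, smul_eq_mul]
        field_simp
      rw [heq, norm_mul, norm_inv, Padic.norm_p, inv_inv]
      calc (p : ℝ) * ‖a‖ ≤ p * (p : ℝ)⁻¹ := by gcongr
        _ = 1 := mul_inv_cancel₀ (by positivity))
  refine ⟨f, hfP, ?_⟩
  rw [hfU w (Submodule.mem_span_singleton_self w)]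
  have heq : (((p : ℚ_[p])⁻¹ * (φ w)⁻¹) • φ) w = (p : ℚ_[p])⁻¹ := by
    simp only [LinearMap.smul_apply, smul_eq_mul]
    field_simp
  rw [heq, norm_inv, Padic.norm_p, inv_inv]
  exact hp

/-- A linear functional bounded on a line vanishes on it. -/
lemma LinearMap.eq_zero_of_norm_smul_le_one (f : W →ₗ[ℚ_[p]] ℚ_[p]) (x : W)
    (h : ∀ c : ℚ_[p], ‖f (c • x)‖ ≤ 1) : f x = 0 := by
  by_contra hx
  have hp : (1 : ℝ) < p := by exact_mod_cast (Fact.out : p.Prime).one_lt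
  have := h ((p : ℚ_[p])⁻¹ * (f x)⁻¹)
  rw [map_smul, smul_eq_mul, mul_assoc, inv_mul_cancel₀ hx, mul_one, norm_inv, Padic.norm_p,
    inv_inv] at this
  linarith

end Separation

section Glue

variable {p : ℕ} [Fact p.Prime] {α k m : ℕ}

lemma Bform_neg_symm {n : ℕ} (x y : SpV p n) : Bform p n x y = -Bform p n y x := by
  simp only [Bform, ← Finset.sum_neg_distrib]
  exact Finset.sum_congr rfl fun _ _ => by ring

lemma glue_add (u u' : Fin α → ℚ_[p]) (x x' : Fin k → Fin m → ℚ_[p]) :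
    glue u x + glue u' x' = glue (u + u') (x + x') := by
  ext (i | i) <;> rfl

lemma smul_glue (c : ℚ_[p]) (u : Fin α → ℚ_[p]) (x : Fin k → Fin m → ℚ_[p]) :
    c • glue u x = glue (c • u) (c • x) := by
  ext (i | i) <;> rfl

lemma exists_eq_glue (a : BigIx α k m → ℚ_[p]) :
    ∃ (u : Fin α → ℚ_[p]) (x : Fin k → Fin m → ℚ_[p]), a = glue u x :=
  ⟨fun i => a (.inl i), fun j s => a (.inr (j, s)), by ext (i | i) <;> rfl⟩

lemma glue_symplectic (up um up' um' : Fin α → ℚ_[p]) (xp xm xp' xm' : Fin k → Fin m → ℚ_[p]) :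
    glue up xp ⬝ᵥ glue um' xm' - glue um xm ⬝ᵥ glue up' xp' =
      Bform p α (up, um) (up', um') +
        ∑ s, Bform p k (tupleSlice xp xm s) (tupleSlice xp' xm' s) := by
  simp only [dotProduct, glue, Fintype.sum_sum_type, Sum.elim_inl, Sum.elim_inr,
    Fintype.sum_prod_type, Bform, tupleSlice, Finset.sum_sub_distrib]
  rw [Finset.sum_comm (f := fun (x : Fin k) (y : Fin m) => xp x y * xm' x y),
    Finset.sum_comm (f := fun (x : Fin k) (y : Fin m) => xm x y * xp' x y)]
  ring

/-- The tensor product `Q ⊗ ℤ_p^m`, as pairs of tuples `(x⁺, x⁻)`. -/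
def slicewise (m : ℕ) (Q : Set (SpV p k)) :
    Set ((Fin k → Fin m → ℚ_[p]) × (Fin k → Fin m → ℚ_[p])) :=
  {x | ∀ s, tupleSlice x.1 x.2 s ∈ Q}

lemma isZpSubmodule_slicewise {Q : Set (SpV p k)} (hQ : IsZpSubmodule p Q) :
    IsZpSubmodule p (slicewise m Q) :=
  ⟨fun _ => hQ.1, fun _ hx _ hy s => hQ.2.1 _ (hx s) _ (hy s),
    fun c hc _ hx s => hQ.2.2 c hc _ (hx s)⟩

/-- Self-duality passes from `Q` to `Q ⊗ ℤ_p^m`. -/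
lemma mem_slicewise_of_integral {Q : Set (SpV p k)} (hQmod : IsZpSubmodule p Q)
    (hQ : IsSelfDual p (Bform p k) Q) (x : (Fin k → Fin m → ℚ_[p]) × (Fin k → Fin m → ℚ_[p]))
    (h : ∀ y ∈ slicewise m Q,
      ‖∑ s, Bform p k (tupleSlice x.1 x.2 s) (tupleSlice y.1 y.2 s)‖ ≤ 1) :
    x ∈ slicewise m Q := by
  intro s
  rw [← hQ]
  intro q hq
  let y : (Fin k → Fin m → ℚ_[p]) × (Fin k → Fin m → ℚ_[p]) :=
    (fun j s' => if s' = s then q.1 j else 0, fun j s' => if s' = s then q.2 j else 0)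
  have hself : tupleSlice y.1 y.2 s = q := by simp [y, tupleSlice]
  have hother : ∀ s', s' ≠ s → tupleSlice y.1 y.2 s' = 0 := by
    intro s' hs'
    simp only [y, tupleSlice, if_neg hs']
    rfl
  have hy : y ∈ slicewise m Q := by
    intro s'
    by_cases hs' : s' = s
    · subst hs'
      rwa [hself]
    · rw [hother s' hs']
      exact hQmod.1
  have := h y hy
  rw [Finset.sum_eq_single s (fun s' _ hs' => by rw [hother s' hs']; simp [Bform]) (by simp),
    hself] at this
  rwa [Bform_neg_symm, norm_neg]

end Glue

section Graph

variable {p : ℕ} [Fact p.Prime] {α k m : ℕ}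

/-- The sum of the graph of `M` (with `(a⁺, a⁻, b⁺, b⁻)` in it when `b⁺ = M a⁺`, `a⁻ = Mᵗ b⁻`)
and of `0 ⊕ (Q ⊗ ℤ_p^m) ⊕ 0 ⊕ (T ⊗ ℤ_p^m)`. -/
def graphSum (M : Matrix (BigIx α k m) (BigIx α k m) ℚ_[p]) (Q T : Set (SpV p k)) :
    Set ((BigIx α k m → ℚ_[p]) × (BigIx α k m → ℚ_[p]) ×
      (BigIx α k m → ℚ_[p]) × (BigIx α k m → ℚ_[p])) :=
  {z | ∃ a b : BigIx α k m → ℚ_[p], ∃ x ∈ slicewise m Q, ∃ y ∈ slicewise m T,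
    z = (a + glue 0 x.1, Mᵀ *ᵥ b + glue 0 x.2, M *ᵥ a + glue 0 y.1, b + glue 0 y.2)}

lemma glue_zero_zero : (glue 0 0 : BigIx α k m → ℚ_[p]) = 0 := by
  ext (i | i) <;> rfl

lemma isZpSubmodule_graphSum (M : Matrix (BigIx α k m) (BigIx α k m) ℚ_[p])
    {Q T : Set (SpV p k)} (hQ : IsZpSubmodule p Q) (hT : IsZpSubmodule p T) :
    IsZpSubmodule p (graphSum M Q T) := by
  have hQm := isZpSubmodule_slicewise (m := m) hQ
  have hTm := isZpSubmodule_slicewise (m := m) hT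
  refine ⟨⟨0, 0, 0, hQm.1, 0, hTm.1, ?_⟩, ?_, ?_⟩
  · simp only [Matrix.mulVec_zero, Prod.fst_zero, Prod.snd_zero, glue_zero_zero, add_zero]
    rfl
  · rintro _ ⟨a, b, x, hx, y, hy, rfl⟩ _ ⟨a', b', x', hx', y', hy', rfl⟩
    refine ⟨a + a', b + b', x + x', hQm.2.1 _ hx _ hx', y + y', hTm.2.1 _ hy _ hy', ?_⟩
    have hg : ∀ z z' : Fin k → Fin m → ℚ_[p],
        (glue 0 (z + z') : BigIx α k m → ℚ_[p]) = glue 0 z + glue 0 z' := by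
      simp [glue_add]
    simp only [Prod.mk_add_mk, Prod.fst_add, Prod.snd_add, hg, Matrix.mulVec_add, Prod.mk.injEq]
    refine ⟨?_, ?_, ?_, ?_⟩ <;> abel
  · rintro c hc _ ⟨a, b, x, hx, y, hy, rfl⟩
    refine ⟨c • a, c • b, c • x, hQm.2.2 c hc _ hx, c • y, hTm.2.2 c hc _ hy, ?_⟩
    simp [smul_glue, Matrix.mulVec_smul]

lemma mem_chiM_of_mem_graphSum {M : Matrix (BigIx α k m) (BigIx α k m) ℚ_[p]}
    {Q T : Set (SpV p k)} (hQ : IsZpSubmodule p Q) (hT : IsZpSubmodule p T)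
    {w : SpV p α × SpV p α}
    (hw : (glue w.1.1 0, glue w.1.2 0, glue w.2.1 0, glue w.2.2 0) ∈ graphSum M Q T) :
    w ∈ chiM p α k m M Q T := by
  obtain ⟨a, b, x, hx, y, hy, h⟩ := hw
  simp only [Prod.mk.injEq] at h
  obtain ⟨h₁, h₂, h₃, h₄⟩ := h
  have hg : ∀ (u : Fin α → ℚ_[p]) (z : Fin k → Fin m → ℚ_[p]) (c : BigIx α k m → ℚ_[p]),
      glue u 0 = c + glue 0 z → glue u (-z) = c := by
    intro u z c h
    have : glue u (-z) + glue 0 z = c + glue 0 z := by simp [← h, glue_add]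
    exact add_right_cancel this
  have hneg : ∀ {S : Set (SpV p k)}, IsZpSubmodule p S → ∀ z ∈ slicewise m S,
      -z ∈ slicewise m S := by
    intro S hS z hz
    simpa using (isZpSubmodule_slicewise hS).2.2 (-1) (by simp) z hz
  refine ⟨-x.1, -x.2, -y.1, -y.2, hneg hQ x hx, hneg hT y hy, ?_, ?_⟩
  · rw [hg _ _ _ h₁, hg _ _ _ h₃]
  · rw [hg _ _ _ h₂, hg _ _ _ h₄]

lemma exists_dotProduct_representation {ι : Type*} [Fintype ι] [DecidableEq ι]
    (f : ((ι → ℚ_[p]) × (ι → ℚ_[p]) × (ι → ℚ_[p]) × (ι → ℚ_[p])) →ₗ[ℚ_[p]] ℚ_[p]) :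
    ∃ a b c d : ι → ℚ_[p], ∀ x y z w,
      f (x, y, z, w) = a ⬝ᵥ x + b ⬝ᵥ y + c ⬝ᵥ z + d ⬝ᵥ w := by
  have repr : ∀ g : (ι → ℚ_[p]) →ₗ[ℚ_[p]] ℚ_[p], ∃ a, ∀ x, g x = a ⬝ᵥ x := fun g => by
    obtain ⟨a, rfl⟩ := (dotProductEquiv ℚ_[p] ι).surjective g
    exact ⟨a, fun _ => rfl⟩
  obtain ⟨a, ha⟩ := repr (f ∘ₗ LinearMap.inl _ _ _)
  obtain ⟨b, hb⟩ := repr (f ∘ₗ LinearMap.inr _ _ _ ∘ₗ LinearMap.inl _ _ _)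
  obtain ⟨c, hc⟩ := repr (f ∘ₗ LinearMap.inr _ _ _ ∘ₗ LinearMap.inr _ _ _ ∘ₗ
    LinearMap.inl _ _ _)
  obtain ⟨d, hd⟩ := repr (f ∘ₗ LinearMap.inr _ _ _ ∘ₗ LinearMap.inr _ _ _ ∘ₗ
    LinearMap.inr _ _ _)
  refine ⟨a, b, c, d, fun x y z w => ?_⟩
  rw [← ha, ← hb, ← hc, ← hd]
  simp only [LinearMap.comp_apply, LinearMap.inl_apply, LinearMap.inr_apply, ← map_add]
  simp

/-- Any functional integral on `graphSum M Q T` restricts to `B^⊖(z, ·)` for some `z ∈ χ_M(Q, T)`. -/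
lemma exists_mem_chiM_of_integral {M : Matrix (BigIx α k m) (BigIx α k m) ℚ_[p]}
    {Q T : Set (SpV p k)} (hQmod : IsZpSubmodule p Q) (hTmod : IsZpSubmodule p T)
    (hQ : IsSelfDual p (Bform p k) Q) (hT : IsSelfDual p (Bform p k) T)
    (f : ((BigIx α k m → ℚ_[p]) × (BigIx α k m → ℚ_[p]) ×
      (BigIx α k m → ℚ_[p]) × (BigIx α k m → ℚ_[p])) →ₗ[ℚ_[p]] ℚ_[p])
    (hf : ∀ z ∈ graphSum M Q T, ‖f z‖ ≤ 1) :
    ∃ z ∈ chiM p α k m M Q T, ∀ w : SpV p α × SpV p α,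
      f (glue w.1.1 0, glue w.1.2 0, glue w.2.1 0, glue w.2.2 0) = Bminus p α z w := by
  have hQm := isZpSubmodule_slicewise (m := m) hQmod
  have hTm := isZpSubmodule_slicewise (m := m) hTmod
  obtain ⟨a, b, c, d, hrep⟩ := exists_dotProduct_representation f
  have hgraph : ∀ s t, f (s, Mᵀ *ᵥ t, M *ᵥ s, t) = 0 := by
    intro s t
    refine f.eq_zero_of_norm_smul_le_one _ fun r => hf _ ?_
    refine ⟨r • s, r • t, 0, hQm.1, 0, hTm.1, ?_⟩
    simp [glue_zero_zero, Matrix.mulVec_smul]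
  have ha : -a = Mᵀ *ᵥ c := by
    rw [neg_eq_iff_add_eq_zero]
    refine dotProduct_eq_zero _ fun s => ?_
    have := hgraph s 0
    simpa [hrep, add_dotProduct, Matrix.dotProduct_mulVec, Matrix.mulVec_transpose] using this
  have hd : -d = M *ᵥ b := by
    rw [neg_eq_iff_add_eq_zero]
    refine dotProduct_eq_zero _ fun t => ?_
    have := hgraph 0 t
    rw [add_comm]
    simpa [hrep, add_dotProduct, Matrix.dotProduct_mulVec, Matrix.vecMul_transpose] using this
  obtain ⟨up, xp, rfl⟩ := exists_eq_glue b
  obtain ⟨um, xm, hum⟩ := exists_eq_glue (-a)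
  obtain ⟨vp, yp, hvp⟩ := exists_eq_glue (-d)
  obtain ⟨vm, ym, rfl⟩ := exists_eq_glue c
  have hform : ∀ (w : SpV p α × SpV p α) (x y : (Fin k → Fin m → ℚ_[p]) × (Fin k → Fin m → ℚ_[p])),
      f (glue w.1.1 x.1, glue w.1.2 x.2, glue w.2.1 y.1, glue w.2.2 y.2) =
        Bminus p α ((up, um), (vp, vm)) w +
          ((∑ s, Bform p k (tupleSlice xp xm s) (tupleSlice x.1 x.2 s)) -
            ∑ s, Bform p k (tupleSlice yp ym s) (tupleSlice y.1 y.2 s)) := by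
    intro w x y
    have h₁ := glue_symplectic up um w.1.1 w.1.2 xp xm x.1 x.2
    have h₂ := glue_symplectic vp vm w.2.1 w.2.2 yp ym y.1 y.2
    rw [← hum, neg_dotProduct] at h₁
    rw [← hvp, neg_dotProduct] at h₂
    rw [hrep, Bminus]
    linear_combination h₁ - h₂
  have hB0 : ∀ z : SpV p k, Bform p k z 0 = 0 := by simp [Bform]
  have hBm0 : ∀ z : SpV p α × SpV p α, Bminus p α z 0 = 0 := by simp [Bminus, Bform]
  have hslice0 : ∀ s : Fin m, (tupleSlice 0 0 s : SpV p k) = 0 := fun _ => rfl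
  have hx : (xp, xm) ∈ slicewise m Q := by
    refine mem_slicewise_of_integral hQmod hQ _ fun x hx => ?_
    have h := hform 0 x 0
    simp only [hBm0, Prod.fst_zero, Prod.snd_zero, hslice0, hB0, Finset.sum_const_zero, sub_zero,
      zero_add] at h
    rw [← h]
    exact hf _ ⟨0, 0, x, hx, 0, hTm.1, by simp [glue_zero_zero]⟩
  have hy : (yp, ym) ∈ slicewise m T := by
    refine mem_slicewise_of_integral hTmod hT _ fun y hy => ?_
    have h := hform 0 0 y
    simp only [hBm0, Prod.fst_zero, Prod.snd_zero, hslice0, hB0, Finset.sum_const_zero, zero_sub,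
      zero_add] at h
    rw [← norm_neg, ← h]
    exact hf _ ⟨0, 0, 0, hQm.1, y, hy, by simp [glue_zero_zero]⟩
  refine ⟨((up, um), (vp, vm)), ⟨xp, xm, yp, ym, hx, hy, ?_, ?_⟩, fun w => ?_⟩
  · rw [← hvp, hd]
  · rw [← hum, ha]
  · have h := hform w 0 0
    simpa only [Prod.fst_zero, Prod.snd_zero, hslice0, hB0, Finset.sum_const_zero, sub_zero,
      add_zero] using h

lemma norm_Bminus_le_one_of_mem_chiM {M : Matrix (BigIx α k m) (BigIx α k m) ℚ_[p]}
    {Q T : Set (SpV p k)} (hQ : IsSelfDual p (Bform p k) Q) (hT : IsSelfDual p (Bform p k) T)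
    {z w : SpV p α × SpV p α} (hz : z ∈ chiM p α k m M Q T) (hw : w ∈ chiM p α k m M Q T) :
    ‖Bminus p α z w‖ ≤ 1 := by
  obtain ⟨xp, xm, yp, ym, hx, hy, h₁, h₂⟩ := hz
  obtain ⟨xp', xm', yp', ym', hx', hy', h₁', h₂'⟩ := hw
  have hB : ∀ {S : Set (SpV p k)}, IsSelfDual p (Bform p k) S → ∀ q ∈ S, ∀ q' ∈ S,
      ‖Bform p k q q'‖ ≤ 1 := fun hS q hq q' hq' => (hS.symm ▸ hq' : q' ∈ dualMod p _ _) q hq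
  have hX := glue_symplectic z.1.1 z.1.2 w.1.1 w.1.2 xp xm xp' xm'
  have hY := glue_symplectic z.2.1 z.2.2 w.2.1 w.2.2 yp ym yp' ym'
  have hXY : glue z.1.1 xp ⬝ᵥ glue w.1.2 xm' - glue z.1.2 xm ⬝ᵥ glue w.1.1 xp' =
      glue z.2.1 yp ⬝ᵥ glue w.2.2 ym' - glue z.2.2 ym ⬝ᵥ glue w.2.1 yp' := by
    rw [h₁, h₂, h₁', h₂', Matrix.dotProduct_mulVec, Matrix.dotProduct_mulVec,
      Matrix.vecMul_transpose, Matrix.mulVec_transpose]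
  have heq : Bminus p α z w =
      (∑ s, Bform p k (tupleSlice yp ym s) (tupleSlice yp' ym' s)) +
        -∑ s, Bform p k (tupleSlice xp xm s) (tupleSlice xp' xm' s) := by
    rw [Bminus]
    linear_combination hXY - hX + hY
  rw [heq]
  refine Padic.norm_add_le_one ?_ ?_
  · exact Padic.norm_sum_le_one fun s _ => hB hT _ (hy s) _ (hy' s)
  · rw [norm_neg]
    exact Padic.norm_sum_le_one fun s _ => hB hQ _ (hx s) _ (hx' s)

end Graph

/-- **Self-duality of values of the characteristic function:** if `Q, T ⊆ H` are self-dual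
`ℤ_p`-submodules (with respect to `B_H`), then for every `g ∈ GL(α + km, ℚ_p)` the submodule
`χ_g(Q, T) ⊆ V ⊕ V` is self-dual with respect to `B^⊖`. -/
theorem chi_self_dual (p : ℕ) [Fact p.Prime] (α k m : ℕ) (hk : 1 ≤ k) (hm : 1 ≤ m)
    (M : Matrix (BigIx α k m) (BigIx α k m) ℚ_[p]) (hM : IsUnit M)
    (Q T : Set (SpV p k)) (hQmod : IsZpSubmodule p Q) (hTmod : IsZpSubmodule p T)
    (hQ : IsSelfDual p (Bform p k) Q) (hT : IsSelfDual p (Bform p k) T) :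
    IsSelfDual p (Bminus p α) (chiM p α k m M Q T) := by
  refine Set.Subset.antisymm (fun w hw => ?_) fun w hw z hz =>
    norm_Bminus_le_one_of_mem_chiM hQ hT hz hw
  refine mem_chiM_of_mem_graphSum hQmod hTmod ?_
  by_contra hnot
  obtain ⟨f, hfP, hfw⟩ :=
    (isZpSubmodule_graphSum M hQmod hTmod).exists_separating_functional hnot
  obtain ⟨z, hz, hzf⟩ := exists_mem_chiM_of_integral hQmod hTmod hQ hT f hfP
  rw [hzf] at hfw
  exact absurd (hw z hz) hfw.not_ge
end

section
/- Multiplicativity of characteristic functions: let g ∈ GL(α+kl, ℚ_p) have blocks a, b_i (α×l), c_i (l×α), d_{ij} (l×l), and h ∈ GL(α+km, ℚ_p) have blocks a', b_i' (α×m), c_i' (m×α), d_{ij}' (m×m). Define f ∈ GL(α+k(l+m), ℚ_p), where each of the k blocks of size l+m is split into an l-part followed by an m-part, by: the α×α block of f is aa'; its α×(l+m) blocks are (b_i | a b_i'); its (l+m)×α blocks are (c_i a' over c_i'); and its (l+m)×(l+m) interior blocks are d_{ij} in the (l,l)-corner, c_i b_j' in the (l,m)-corner, 0 in the (m,l)-corner,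 and d_{ij}' in the (m,m)-corner. Then for all self-dual ℤ_p-submodules Q, T ⊆ H: χ_f(Q,T) = {u ⊕ w ∈ V⊕V : ∃ v ∈ V, u ⊕ v ∈ χ_h(Q,T) and v ⊕ w ∈ χ_g(Q,T)}, i.e. χ_f(Q,T) is the composition of the relations χ_g(Q,T) and χ_h(Q,T). -/
open scoped BigOperators

/-- The element `f ∈ GL(α + k(l+m), ℚ_p)` representing the product of the double cosets of
`g ∈ GL(α + kl, ℚ_p)` and `h ∈ GL(α + km, ℚ_p)`: its blocks are `aa'`, `(b_i | a b_i')`,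
`(c_i a'` over `c_i')`, and interior blocks `d_{ij}`, `c_i b_j'`, `0`, `d_{ij}'`. -/
noncomputable def combineM (p α k l m : ℕ) [Fact p.Prime]
    (G : Matrix (BigIx α k l) (BigIx α k l) ℚ_[p])
    (H : Matrix (BigIx α k m) (BigIx α k m) ℚ_[p]) :
    Matrix (BigIx α k (l + m)) (BigIx α k (l + m)) ℚ_[p] :=
  fun i j =>
    match i, j with
    | Sum.inl r, Sum.inl r' =>
        ∑ q : Fin α, G (Sum.inl r) (Sum.inl q) * H (Sum.inl q) (Sum.inl r')
    | Sum.inl r, Sum.inr jt =>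
        if ht : (jt.2 : ℕ) < l then G (Sum.inl r) (Sum.inr (jt.1, ⟨jt.2, ht⟩))
        else ∑ q : Fin α, G (Sum.inl r) (Sum.inl q) *
          H (Sum.inl q) (Sum.inr (jt.1, ⟨(jt.2 : ℕ) - l, by have := jt.2.isLt; omega⟩))
    | Sum.inr is, Sum.inl r =>
        if hs : (is.2 : ℕ) < l then
          ∑ q : Fin α, G (Sum.inr (is.1, ⟨is.2, hs⟩)) (Sum.inl q) * H (Sum.inl q) (Sum.inl r)
        else H (Sum.inr (is.1, ⟨(is.2 : ℕ) - l, by have := is.2.isLt; omega⟩)) (Sum.inl r)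
    | Sum.inr is, Sum.inr jt =>
        if hs : (is.2 : ℕ) < l then
          if ht : (jt.2 : ℕ) < l then
            G (Sum.inr (is.1, ⟨is.2, hs⟩)) (Sum.inr (jt.1, ⟨jt.2, ht⟩))
          else
            ∑ q : Fin α, G (Sum.inr (is.1, ⟨is.2, hs⟩)) (Sum.inl q) *
              H (Sum.inl q) (Sum.inr (jt.1, ⟨(jt.2 : ℕ) - l, by have := jt.2.isLt; omega⟩))
        else
          if (jt.2 : ℕ) < l then 0
          else
            H (Sum.inr (is.1, ⟨(is.2 : ℕ) - l, by have := is.2.isLt; omega⟩))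
              (Sum.inr (jt.1, ⟨(jt.2 : ℕ) - l, by have := jt.2.isLt; omega⟩))

section combineM

open Matrix

variable {p α k l m : ℕ} [Fact p.Prime]
  (G : Matrix (BigIx α k l) (BigIx α k l) ℚ_[p]) (H : Matrix (BigIx α k m) (BigIx α k m) ℚ_[p])

lemma mulVec_glue (M : Matrix (BigIx α k m) (BigIx α k m) ℚ_[p]) (u : Fin α → ℚ_[p])
    (x : Fin k → Fin m → ℚ_[p]) (i : BigIx α k m) :
    (M *ᵥ glue u x) i =
      ∑ q, M i (Sum.inl q) * u q + ∑ js : Fin k × Fin m, M i (Sum.inr js) * x js.1 js.2 := by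
  simp [mulVec, dotProduct, glue]

lemma glue_eq_iff (u : Fin α → ℚ_[p]) (x : Fin k → Fin m → ℚ_[p]) (z : BigIx α k m → ℚ_[p]) :
    glue u x = z ↔ (∀ r, u r = z (Sum.inl r)) ∧ ∀ j s, x j s = z (Sum.inr (j, s)) := by
  simp [funext_iff, glue]

lemma glue_eq_iff_add (u : Fin α → ℚ_[p]) (x : Fin k → Fin (l + m) → ℚ_[p])
    (z : BigIx α k (l + m) → ℚ_[p]) :
    glue u x = z ↔ (∀ r, u r = z (Sum.inl r)) ∧
      (∀ j s, x j (Fin.castAdd m s) = z (Sum.inr (j, Fin.castAdd m s))) ∧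
      ∀ j s, x j (Fin.natAdd l s) = z (Sum.inr (j, Fin.natAdd l s)) := by
  simp only [glue_eq_iff, Fin.forall_fin_add, forall_and]

lemma sum_sum_mul_mul {ι κ R : Type*} [CommSemiring R] (s : Finset ι) (t : Finset κ) (A : ι → R)
    (B : ι → κ → R) (x : κ → R) :
    ∑ j ∈ t, (∑ q ∈ s, A q * B q j) * x j = ∑ q ∈ s, A q * ∑ j ∈ t, B q j * x j := by
  simp only [Finset.sum_mul, Finset.mul_sum, mul_assoc]
  exact Finset.sum_comm

/-- `combineM` acts as `H` on the last `m` coordinates of each block, followed by `G` on the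
first `l` coordinates. -/
lemma glue_eq_combineM_mulVec_iff (u w : Fin α → ℚ_[p]) (x y : Fin k → Fin (l + m) → ℚ_[p]) :
    glue w y = combineM p α k l m G H *ᵥ glue u x ↔
      ∃ v : Fin α → ℚ_[p],
        glue v (fun j s => y j (Fin.natAdd l s)) =
          H *ᵥ glue u (fun j s => x j (Fin.natAdd l s)) ∧
        glue w (fun j s => y j (Fin.castAdd m s)) =
          G *ᵥ glue v (fun j s => x j (Fin.castAdd m s)) := by
  have hsum (A : Fin α → ℚ_[p]) :
      ∑ q, A q * (H *ᵥ glue u (fun j s => x j (Fin.natAdd l s))) (Sum.inl q) =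
        ∑ r, (∑ q, A q * H (Sum.inl q) (Sum.inl r)) * u r +
          ∑ js : Fin k × Fin m,
            (∑ q, A q * H (Sum.inl q) (Sum.inr js)) * x js.1 (Fin.natAdd l js.2) := by
    simp only [mulVec_glue, mul_add, Finset.sum_add_distrib, sum_sum_mul_mul]
  trans glue (fun q => (H *ᵥ glue u (fun j s => x j (Fin.natAdd l s))) (Sum.inl q))
        (fun j s => y j (Fin.natAdd l s)) =
          H *ᵥ glue u (fun j s => x j (Fin.natAdd l s)) ∧
        glue w (fun j s => y j (Fin.castAdd m s)) =
          G *ᵥ glue (fun q => (H *ᵥ glue u (fun j s => x j (Fin.natAdd l s))) (Sum.inl q))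
            (fun j s => x j (Fin.castAdd m s))
  · rw [glue_eq_iff_add, glue_eq_iff, glue_eq_iff]
    simp only [mulVec_glue G, hsum]
    simp [mulVec_glue, combineM, Fintype.sum_prod_type, Fin.sum_univ_add, Finset.sum_add_distrib]
    grind
  · refine ⟨fun h => ⟨_, h⟩, ?_⟩
    rintro ⟨v, hv, hw⟩
    obtain rfl : v = fun q => (H *ᵥ glue u (fun j s => x j (Fin.natAdd l s))) (Sum.inl q) :=
      funext ((glue_eq_iff _ _ _).1 hv).1
    exact ⟨hv, hw⟩

/-- Interchanging the two parts of each interior block turns the transpose of `combineM G H`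
into `combineM Hᵀ Gᵀ`. -/
lemma transpose_combineM :
    (combineM p α k l m G H)ᵀ =
      (combineM p α k m l Hᵀ Gᵀ).submatrix
        ((Equiv.refl _).sumCongr ((Equiv.refl _).prodCongr finAddFlip))
        ((Equiv.refl _).sumCongr ((Equiv.refl _).prodCongr finAddFlip)) := by
  ext (r | ⟨j, s⟩) (r' | ⟨j', s'⟩)
  · simp [combineM, mul_comm]
  · refine Fin.addCases (fun s' => ?_) (fun s' => ?_) s' <;> simp [combineM, mul_comm]
  · refine Fin.addCases (fun s => ?_) (fun s => ?_) s <;> simp [combineM, mul_comm]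
  · refine Fin.addCases (fun s => ?_) (fun s => ?_) s <;>
    refine Fin.addCases (fun s' => ?_) (fun s' => ?_) s' <;> simp [combineM, mul_comm]

lemma glue_eq_transpose_combineM_mulVec_iff (u w : Fin α → ℚ_[p])
    (x y : Fin k → Fin (l + m) → ℚ_[p]) :
    glue u x = (combineM p α k l m G H)ᵀ *ᵥ glue w y ↔
      ∃ v : Fin α → ℚ_[p],
        glue u (fun j s => x j (Fin.natAdd l s)) =
          Hᵀ *ᵥ glue v (fun j s => y j (Fin.natAdd l s)) ∧
        glue v (fun j s => x j (Fin.castAdd m s)) =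
          Gᵀ *ᵥ glue w (fun j s => y j (Fin.castAdd m s)) := by
  trans glue u (fun j s => x j (finAddFlip s)) =
    combineM p α k m l Hᵀ Gᵀ *ᵥ glue w (fun j s => y j (finAddFlip s))
  · have hglue : glue w y ∘ ((Equiv.refl _).sumCongr ((Equiv.refl _).prodCongr finAddFlip)).symm =
        glue w (fun j s => y j (finAddFlip s)) := by
      ext (r | ⟨j, s⟩)
      · rfl
      · refine congrArg (y j) ((Equiv.symm_apply_eq _).2 ?_)
        refine Fin.addCases (fun s => ?_) (fun s => ?_) s <;> simp
    rw [transpose_combineM, submatrix_mulVec_equiv, hglue]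
    simp only [glue_eq_iff_add]
    simp [and_comm]
  · rw [glue_eq_combineM_mulVec_iff]
    simp [and_comm]

end combineM

/-- **Multiplicativity of characteristic functions:** for `g ∈ GL(α + kl, ℚ_p)`,
`h ∈ GL(α + km, ℚ_p)` and the combined element `f ∈ GL(α + k(l+m), ℚ_p)`, and all self-dual
`ℤ_p`-submodules `Q, T ⊆ H`, the set `χ_f(Q, T)` is the composition of the relations
`χ_g(Q, T)` and `χ_h(Q, T)`. -/
theorem chi_multiplicativity (p : ℕ) [Fact p.Prime] (α k l m : ℕ)
    (hk : 1 ≤ k) (hl : 1 ≤ l) (hm : 1 ≤ m)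
    (G : Matrix (BigIx α k l) (BigIx α k l) ℚ_[p]) (hG : IsUnit G)
    (H : Matrix (BigIx α k m) (BigIx α k m) ℚ_[p]) (hH : IsUnit H)
    (Q T : Set (SpV p k)) (hQmod : IsZpSubmodule p Q) (hTmod : IsZpSubmodule p T)
    (hQ : IsSelfDual p (Bform p k) Q) (hT : IsSelfDual p (Bform p k) T) :
    chiM p α k (l + m) (combineM p α k l m G H) Q T =
      {uw : SpV p α × SpV p α | ∃ v : SpV p α,
        (uw.1, v) ∈ chiM p α k m H Q T ∧ (v, uw.2) ∈ chiM p α k l G Q T} := by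
  ext ⟨⟨up, um⟩, ⟨wp, wm⟩⟩
  simp only [chiM, Set.mem_ofPred_eq, glue_eq_combineM_mulVec_iff,
    glue_eq_transpose_combineM_mulVec_iff, Fin.forall_fin_add]
  constructor
  · rintro ⟨xp, xm, yp, ym, ⟨hxl, hxm⟩, ⟨hyl, hym⟩, ⟨vp, hvp, hwp⟩, ⟨vm, hum, hvm⟩⟩
    exact ⟨(vp, vm), ⟨_, _, _, _, hxm, hym, hvp, hum⟩, ⟨_, _, _, _, hxl, hyl, hwp, hvm⟩⟩
  · rintro ⟨⟨vp, vm⟩, ⟨xp', xm', yp', ym', hx', hy', hvp, hum⟩,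
      ⟨xp, xm, yp, ym, hx, hy, hwp, hvm⟩⟩
    refine ⟨fun j => Fin.append (xp j) (xp' j), fun j => Fin.append (xm j) (xm' j),
      fun j => Fin.append (yp j) (yp' j), fun j => Fin.append (ym j) (ym' j), ?_⟩
    simp only [tupleSlice, Fin.append_left, Fin.append_right] at *
    exact ⟨⟨hx, hx'⟩, ⟨hy, hy'⟩, ⟨vp, hvp, hwp⟩, ⟨vm, hum, hvm⟩⟩
end

section
/- Let g ∈ GL(α+km, ℚ_p) with blocks a, b_j, c_i, d_{ij}, and let Λ(g) ⊆ V⊕V be the ℚ_p-linear subspace of all (u⁺⊕u⁻) ⊕ (v⁺⊕v⁻) with v⁺ = a u⁺, c_i u⁺ = 0 for all i, u⁻ = aᵗ v⁻, and b_jᵗ v⁻ = 0 for all j. (a) For all self-dual ℤ_p-submodules Q, T ⊆ H: Λ(g) ⊆ χ_g(Q,T)_↓ and χ_g(Q,T)^↑ ⊆ Λ(g)^⊥, where Λ(g)^⊥ = {z ∈ V⊕V : B^⊖(z,z') = 0 for all z' ∈ Λ(g)}. (b) If Q and T are self-dual lattices in H, then χ_g(Q,T)_↓ = Λ(g) and χ_g(Q,T)^↑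 = Λ(g)^⊥. -/
open scoped BigOperators

/-- The subspace `Λ(g) ⊆ V ⊕ V` of solutions of `v⁺ = a u⁺`, `c_i u⁺ = 0`, `u⁻ = aᵗ v⁻`,
`b_jᵗ v⁻ = 0`; equivalently `(v⁺, 0) = g (u⁺, 0)` and `(u⁻, 0) = gᵗ (v⁻, 0)`. -/
def LambdaM (p α k m : ℕ) [Fact p.Prime]
    (M : Matrix (BigIx α k m) (BigIx α k m) ℚ_[p]) : Set (SpV p α × SpV p α) :=
  {uv | glue uv.2.1 (fun _ _ => 0) = M.mulVec (glue uv.1.1 (fun _ _ => 0)) ∧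
        glue uv.1.2 (fun _ _ => 0) = M.transpose.mulVec (glue uv.2.2 (fun _ _ => 0))}

/-- The largest `ℚ_p`-linear subspace `R_↓` contained in a `ℤ_p`-submodule `R`. -/
def Rdown (p : ℕ) [Fact p.Prime] {X : Type*} [AddCommGroup X] [Module ℚ_[p] X]
    (R : Set X) : Set X :=
  {x | ∀ c : ℚ_[p], c • x ∈ R}

/-- The `B^⊖`-orthocomplement `Λ^⊥ = {z : B^⊖(z, z') = 0 for all z' ∈ Λ}`. -/
def BminusPerp (p α : ℕ) [Fact p.Prime] (Λ : Set (SpV p α × SpV p α)) :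
    Set (SpV p α × SpV p α) :=
  {z | ∀ z' ∈ Λ, Bminus p α z z' = 0}

/-- A vector orthogonal to the kernel of `Aᵀ` lies in the range of `A`. -/
lemma Matrix.exists_mulVec_eq_of_forall_dotProduct_eq_zero {K m n : Type*} [Field K] [Fintype m]
    [Fintype n] (A : Matrix m n K) (w : m → K)
    (h : ∀ v, A.transpose.mulVec v = 0 → v ⬝ᵥ w = 0) : ∃ x, A.mulVec x = w := by
  classical
  by_contra hw
  obtain ⟨f, hf, hle⟩ := Submodule.exists_le_ker_of_notMem
    (p := LinearMap.range A.mulVecLin) (v := w) (by simpa using hw)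
  obtain ⟨v, rfl⟩ := (dotProductEquiv K m).surjective f
  refine hf (h v ?_)
  rw [← dotProduct_eq_zero_iff]
  intro x
  rw [Matrix.mulVec_transpose, ← Matrix.dotProduct_mulVec]
  exact hle (LinearMap.mem_range_self A.mulVecLin x)

section

variable {p : ℕ} [Fact p.Prime] {α k m : ℕ}

lemma Bform_eq_dotProduct (n : ℕ) (x y : SpV p n) :
    Bform p n x y = x.1 ⬝ᵥ y.2 - x.2 ⬝ᵥ y.1 := by
  simp [Bform, dotProduct, Finset.sum_sub_distrib]

lemma norm_Bform_le (n : ℕ) (x y : SpV p n) : ‖Bform p n x y‖ ≤ ‖x‖ * ‖y‖ := by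
  have hle (a b : ℚ_[p]) (ha : ‖a‖ ≤ ‖x‖) (hb : ‖b‖ ≤ ‖y‖) : ‖a * b‖ ≤ ‖x‖ * ‖y‖ := by
    rw [norm_mul]
    gcongr
  refine IsUltrametricDist.norm_sum_le_of_forall_le_of_nonneg (by positivity) fun s _ => ?_
  rw [sub_eq_add_neg]
  refine (IsUltrametricDist.norm_add_le_max _ _).trans (max_le ?_ ((norm_neg _).trans_le ?_))
  · exact hle _ _ ((norm_le_pi_norm _ s).trans (norm_fst_le x))
      ((norm_le_pi_norm _ s).trans (norm_snd_le y))
  · exact hle _ _ ((norm_le_pi_norm _ s).trans (norm_snd_le x))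
      ((norm_le_pi_norm _ s).trans (norm_fst_le y))

open Topology in
/-- A bounded self-dual set is a neighbourhood of zero. -/
lemma IsSelfDual.mem_nhds_zero {Q : Set (SpV p k)} (hQ : IsSelfDual p (Bform p k) Q)
    (hb : Bornology.IsBounded Q) : Q ∈ 𝓝 0 := by
  obtain ⟨C, hC, hQC⟩ := hb.exists_pos_norm_le
  refine Filter.mem_of_superset (Metric.closedBall_mem_nhds 0 (inv_pos.2 hC)) fun w hw => ?_
  rw [← hQ]
  intro v hv
  rw [mem_closedBall_zero_iff] at hw
  calc ‖Bform p k v w‖ ≤ ‖v‖ * ‖w‖ := norm_Bform_le k v w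
    _ ≤ C * C⁻¹ := by gcongr; exact hQC v hv
    _ = 1 := mul_inv_cancel₀ hC.ne'

@[simp]
lemma glue_zero : glue (p := p) (0 : Fin α → ℚ_[p]) (fun (_ : Fin k) (_ : Fin m) => 0) = 0 := by
  ext (i | i) <;> rfl

lemma glue_smul (c : ℚ_[p]) (u : Fin α → ℚ_[p]) (x : Fin k → Fin m → ℚ_[p]) :
    glue (c • u) (c • x) = c • glue u x := by
  ext (i | i) <;> rfl

lemma glue_dotProduct_glue_zero (u v : Fin α → ℚ_[p]) (x : Fin k → Fin m → ℚ_[p]) :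
    glue u x ⬝ᵥ glue v (fun _ _ => 0) = u ⬝ᵥ v := by
  simp [glue, dotProduct]

lemma continuous_glue (u : Fin α → ℚ_[p]) :
    Continuous fun x : Fin k → Fin m → ℚ_[p] => glue u x := by
  refine continuous_pi ?_
  rintro (i | i)
  · exact continuous_const
  · exact (continuous_apply i.2).comp (continuous_apply i.1)

lemma dotProduct_eq_of_glue_eq {M : Matrix (BigIx α k m) (BigIx α k m) ℚ_[p]}
    {u v u' v' : Fin α → ℚ_[p]} {x y : Fin k → Fin m → ℚ_[p]}
    (h : glue v y = M.mulVec (glue u x))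
    (h' : glue u' (fun _ _ => 0) = M.transpose.mulVec (glue v' (fun _ _ => 0))) :
    v ⬝ᵥ v' = u ⬝ᵥ u' := by
  rw [← glue_dotProduct_glue_zero v v' y, ← glue_dotProduct_glue_zero u u' x, h, h',
    Matrix.mulVec_transpose, dotProduct_comm, Matrix.dotProduct_mulVec, dotProduct_comm]

lemma exists_glue_eq_of_forall_dotProduct_eq (M : Matrix (BigIx α k m) (BigIx α k m) ℚ_[p])
    (u v : Fin α → ℚ_[p])
    (h : ∀ u' v' : Fin α → ℚ_[p],
      glue u' (fun _ _ => 0) = M.transpose.mulVec (glue v' (fun (_ : Fin k) (_ : Fin m) => 0)) →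
      v ⬝ᵥ v' = u ⬝ᵥ u') :
    ∃ x y : Fin k → Fin m → ℚ_[p], glue v y = M.mulVec (glue u x) := by
  obtain ⟨a, b, c, d, rfl⟩ : ∃ a b c d, M = Matrix.fromBlocks a b c d :=
    ⟨_, _, _, _, (Matrix.fromBlocks_toBlocks M).symm⟩
  obtain ⟨x, hx⟩ := b.exists_mulVec_eq_of_forall_dotProduct_eq_zero (v - a.mulVec u) (by
    intro v' hv'
    have := h (a.transpose.mulVec v') v' (by
      rw [Matrix.fromBlocks_transpose, Matrix.fromBlocks_mulVec]
      ext (i | i)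
      · simp [glue, Function.comp_def, ← Pi.zero_def]
      · simpa [glue, Function.comp_def, ← Pi.zero_def] using (congrFun hv' i).symm)
    rw [dotProduct_sub, Matrix.dotProduct_mulVec, ← Matrix.mulVec_transpose, dotProduct_comm,
      this, dotProduct_comm u, sub_self])
  refine ⟨fun j s => x (j, s), fun i s => (c.mulVec u + d.mulVec x) (i, s), ?_⟩
  rw [Matrix.fromBlocks_mulVec]
  ext (i | i)
  · simpa [glue, Function.comp_def] using congrFun (sub_eq_iff_eq_add'.1 hx.symm) i
  · simp [glue, Function.comp_def]

lemma norm_le_of_forall_tupleSlice {Q : Set (SpV p k)} {C : ℝ} (hC : 0 ≤ C)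
    (hQ : ∀ q ∈ Q, ‖q‖ ≤ C) {xp xm : Fin k → Fin m → ℚ_[p]}
    (hx : ∀ s, tupleSlice xp xm s ∈ Q) : ‖xp‖ ≤ C ∧ ‖xm‖ ≤ C := by
  simp only [pi_norm_le_iff_of_nonneg hC]
  refine ⟨fun j s => ?_, fun j s => ?_⟩
  · exact ((norm_le_pi_norm _ j).trans (norm_fst_le (tupleSlice xp xm s))).trans (hQ _ (hx s))
  · exact ((norm_le_pi_norm _ j).trans (norm_snd_le (tupleSlice xp xm s))).trans (hQ _ (hx s))

open Filter Topology in
/-- If all multiples of `(u, v)` extend to solutions of the linear system with bounded tuples,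
then `(u, v)` extends by zero. -/
lemma glue_zero_eq_of_forall_smul {M : Matrix (BigIx α k m) (BigIx α k m) ℚ_[p]}
    {u v : Fin α → ℚ_[p]} {x y : ℚ_[p] → Fin k → Fin m → ℚ_[p]} {C D : ℝ}
    (hx : ∀ c, ‖x c‖ ≤ C) (hy : ∀ c, ‖y c‖ ≤ D)
    (h : ∀ c, glue (c • v) (y c) = M.mulVec (glue (c • u) (x c))) :
    glue v (fun _ _ => 0) = M.mulVec (glue u (fun _ _ => 0)) := by
  have hlim {E : ℝ} {z : ℚ_[p] → Fin k → Fin m → ℚ_[p]} (hz : ∀ c, ‖z c‖ ≤ E)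
      (w : Fin α → ℚ_[p]) :
      Tendsto (fun c : ℚ_[p] => glue w (c • z c⁻¹)) (𝓝[≠] 0) (𝓝 (glue w fun _ _ => 0)) := by
    refine ((continuous_glue w).tendsto 0).comp ?_
    exact (tendsto_id.mono_left nhdsWithin_le_nhds).zero_smul_isBoundedUnder_le
      (isBoundedUnder_of ⟨E, fun c => hz c⁻¹⟩)
  have hM : Continuous M.mulVec := M.mulVecLin.continuous_of_finiteDimensional
  refine tendsto_nhds_unique (hlim hy v) (((hM.tendsto _).comp (hlim hx u)).congr' ?_)
  filter_upwards [self_mem_nhdsWithin] with c hc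
  have := congrArg (c • ·) (h c⁻¹)
  simpa only [Function.comp_apply, ← Matrix.mulVec_smul, ← glue_smul,
    smul_inv_smul₀ (show c ≠ 0 from hc)] using this.symm

lemma LambdaM_subset_Rdown (M : Matrix (BigIx α k m) (BigIx α k m) ℚ_[p]) {Q T : Set (SpV p k)}
    (hQ : (0 : SpV p k) ∈ Q) (hT : (0 : SpV p k) ∈ T) :
    LambdaM p α k m M ⊆ Rdown p (chiM p α k m M Q T) := by
  rintro z ⟨h1, h2⟩ c
  have hsmul {N : Matrix (BigIx α k m) (BigIx α k m) ℚ_[p]} {u v : Fin α → ℚ_[p]}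
      (h : glue v (fun _ _ => 0) = N.mulVec (glue u (fun _ _ => 0))) :
      glue (c • v) (c • 0) = N.mulVec (glue (c • u) (c • 0)) := by
    rw [glue_smul, glue_smul, Matrix.mulVec_smul]
    exact congrArg (c • ·) h
  refine ⟨c • 0, c • 0, c • 0, c • 0, fun _ => ?_, fun _ => ?_, hsmul h1, hsmul h2⟩
  · rw [smul_zero]
    exact hQ
  · rw [smul_zero]
    exact hT

lemma Bminus_eq_dotProduct (z w : SpV p α × SpV p α) :
    Bminus p α z w = z.1.1 ⬝ᵥ w.1.2 - z.1.2 ⬝ᵥ w.1.1 - (z.2.1 ⬝ᵥ w.2.2 - z.2.2 ⬝ᵥ w.2.1) := by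
  simp only [Bminus, Bform_eq_dotProduct]

lemma span_chiM_subset_BminusPerp (M : Matrix (BigIx α k m) (BigIx α k m) ℚ_[p])
    (Q T : Set (SpV p k)) :
    (Submodule.span ℚ_[p] (chiM p α k m M Q T) : Set (SpV p α × SpV p α)) ⊆
      BminusPerp p α (LambdaM p α k m M) := by
  intro z hz z' hz'
  induction hz using Submodule.span_induction with
  | mem z hz =>
    obtain ⟨xp, xm, yp, ym, -, -, h1, h2⟩ := hz
    have e1 := dotProduct_eq_of_glue_eq h1 hz'.2
    have e2 := dotProduct_eq_of_glue_eq h2 (by simpa using hz'.1)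
    rw [Bminus_eq_dotProduct, e1, e2]
    ring
  | zero => simp [Bminus_eq_dotProduct]
  | add x y _ _ hx hy =>
    rw [Bminus_eq_dotProduct] at *
    simp only [Prod.fst_add, Prod.snd_add, add_dotProduct]
    linear_combination hx + hy
  | smul c x _ hx =>
    rw [Bminus_eq_dotProduct] at *
    simp only [Prod.smul_fst, Prod.smul_snd, smul_dotProduct, smul_eq_mul]
    linear_combination c * hx

lemma Rdown_chiM_subset_LambdaM (M : Matrix (BigIx α k m) (BigIx α k m) ℚ_[p])
    {Q T : Set (SpV p k)} (hQ : Bornology.IsBounded Q) (hT : Bornology.IsBounded T) :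
    Rdown p (chiM p α k m M Q T) ⊆ LambdaM p α k m M := by
  intro z hz
  obtain ⟨C, hC, hQC⟩ := hQ.exists_pos_norm_le
  obtain ⟨D, hD, hTD⟩ := hT.exists_pos_norm_le
  choose xp xm yp ym hx hy h1 h2 using hz
  have hx' c := norm_le_of_forall_tupleSlice hC.le hQC (hx c)
  have hy' c := norm_le_of_forall_tupleSlice hD.le hTD (hy c)
  exact ⟨glue_zero_eq_of_forall_smul (fun c => (hx' c).1) (fun c => (hy' c).1) h1,
    glue_zero_eq_of_forall_smul (fun c => (hy' c).2) (fun c => (hx' c).2) h2⟩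

open Filter Topology in
lemma BminusPerp_subset_span_chiM (M : Matrix (BigIx α k m) (BigIx α k m) ℚ_[p])
    {Q T : Set (SpV p k)} (hQ : Q ∈ 𝓝 0) (hT : T ∈ 𝓝 0) :
    BminusPerp p α (LambdaM p α k m M) ⊆
      (Submodule.span ℚ_[p] (chiM p α k m M Q T) : Set (SpV p α × SpV p α)) := by
  intro z hz
  obtain ⟨xp, yp, h1⟩ := exists_glue_eq_of_forall_dotProduct_eq M z.1.1 z.2.1 (by
    intro u' v' h
    have := hz ((0, u'), (0, v')) ⟨by simp, h⟩
    rw [Bminus_eq_dotProduct] at this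
    simp only [dotProduct_zero, sub_zero] at this
    exact (sub_eq_zero.1 this).symm)
  obtain ⟨ym, xm, h2⟩ := exists_glue_eq_of_forall_dotProduct_eq M.transpose z.2.2 z.1.2 (by
    intro v' u' h
    have := hz ((u', 0), (v', 0)) ⟨by simpa using h, by simp⟩
    rw [Bminus_eq_dotProduct] at this
    simp only [dotProduct_zero, zero_sub] at this
    linear_combination -this)
  have hev {P : Set (SpV p k)} (hP : P ∈ 𝓝 0) (w : SpV p k) :
      ∀ᶠ c : ℚ_[p] in 𝓝[≠] 0, c • w ∈ P := by
    have hc : Tendsto (fun c : ℚ_[p] => c • w) (𝓝 0) (𝓝 0) := by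
      exact Continuous.tendsto' (by fun_prop) _ _ (zero_smul _ w)
    exact (hc.eventually_mem hP).filter_mono nhdsWithin_le_nhds
  obtain ⟨c, hxc, hyc, hc⟩ := ((eventually_all.2 fun s => hev hQ (tupleSlice xp xm s)).and
    ((eventually_all.2 fun s => hev hT (tupleSlice yp ym s)).and
      self_mem_nhdsWithin)).exists
  refine (Submodule.smul_mem_iff _ (show c ≠ 0 from hc)).1 (Submodule.subset_span ?_)
  refine ⟨c • xp, c • xm, c • yp, c • ym, hxc, hyc, ?_, ?_⟩
  · simp only [Prod.smul_fst, Prod.smul_snd, glue_smul, Matrix.mulVec_smul, h1]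
  · simp only [Prod.smul_fst, Prod.smul_snd, glue_smul, Matrix.mulVec_smul, h2]

end

/-- **Refinement of the self-duality theorem.** (a) For all self-dual `ℤ_p`-submodules
`Q, T ⊆ H`: `Λ(g) ⊆ χ_g(Q,T)_↓` and `χ_g(Q,T)^↑ ⊆ Λ(g)^⊥`. (b) If `Q` and `T` are self-dual
lattices, then `χ_g(Q,T)_↓ = Λ(g)` and `χ_g(Q,T)^↑ = Λ(g)^⊥`. -/
theorem chi_Lambda (p : ℕ) [Fact p.Prime] (α k m : ℕ) (hk : 1 ≤ k) (hm : 1 ≤ m)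
    (M : Matrix (BigIx α k m) (BigIx α k m) ℚ_[p]) (hM : IsUnit M)
    (Q T : Set (SpV p k)) (hQmod : IsZpSubmodule p Q) (hTmod : IsZpSubmodule p T)
    (hQ : IsSelfDual p (Bform p k) Q) (hT : IsSelfDual p (Bform p k) T) :
    (LambdaM p α k m M ⊆ Rdown p (chiM p α k m M Q T) ∧
      (Submodule.span ℚ_[p] (chiM p α k m M Q T) : Set (SpV p α × SpV p α)) ⊆
        BminusPerp p α (LambdaM p α k m M)) ∧
    ((IsCompact Q ∧ Submodule.span ℚ_[p] Q = ⊤ ∧ IsCompact T ∧ Submodule.span ℚ_[p] T = ⊤) →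
      Rdown p (chiM p α k m M Q T) = LambdaM p α k m M ∧
      (Submodule.span ℚ_[p] (chiM p α k m M Q T) : Set (SpV p α × SpV p α)) =
        BminusPerp p α (LambdaM p α k m M)) := by
  refine ⟨⟨LambdaM_subset_Rdown M hQmod.1 hTmod.1, span_chiM_subset_BminusPerp M Q T⟩, ?_⟩
  rintro ⟨hQc, -, hTc, -⟩
  exact ⟨(Rdown_chiM_subset_LambdaM M hQc.isBounded hTc.isBounded).antisymm
      (LambdaM_subset_Rdown M hQmod.1 hTmod.1),
    (span_chiM_subset_BminusPerp M Q T).antisymm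
      (BminusPerp_subset_span_chiM M (hQ.mem_nhds_zero hQc.isBounded)
        (hT.mem_nhds_zero hTc.isBounded))⟩
end

section
/- Values on the distinguished boundary: if Q and T are Lagrangian ℚ_p-subspaces of H (k-dimensional subspaces on which B_H vanishes identically), then for every g ∈ GL(α+km, ℚ_p) the set χ_g(Q,T) is a Lagrangian subspace of (V⊕V, B^⊖), i.e. a 2α-dimensional ℚ_p-linear subspace on which B^⊖ vanishes identically. -/
open scoped BigOperators

open LinearMap Matrix Module

section SymplecticReduction

variable {K : Type*} [Field K] {ι α κ μ : Type*}

/-- The orthogonal complement of an intersection is the sum of the orthogonal complements. -/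
theorem LinearMap.BilinForm.orthogonal_inf {V : Type*} [AddCommGroup V] [Module K V]
    [FiniteDimensional K V] {B : LinearMap.BilinForm K V} (hB : B.Nondegenerate) (hB₀ : B.IsRefl)
    (W₁ W₂ : Submodule K V) :
    B.orthogonal (W₁ ⊓ W₂) = B.orthogonal W₁ ⊔ B.orthogonal W₂ := by
  rw [← LinearMap.BilinForm.orthogonal_orthogonal hB hB₀ (B.orthogonal W₁ ⊔ B.orthogonal W₂)]
  refine le_antisymm (LinearMap.BilinForm.orthogonal_le (le_inf ?_ ?_))
    (LinearMap.BilinForm.orthogonal_le ?_)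
  · exact (LinearMap.BilinForm.orthogonal_le le_sup_left).trans_eq
      (LinearMap.BilinForm.orthogonal_orthogonal hB hB₀ W₁)
  · exact (LinearMap.BilinForm.orthogonal_le le_sup_right).trans_eq
      (LinearMap.BilinForm.orthogonal_orthogonal hB hB₀ W₂)
  · refine (LinearMap.BilinForm.le_orthogonal_orthogonal hB₀).trans
      (LinearMap.BilinForm.orthogonal_le (sup_le ?_ ?_))
    · exact LinearMap.BilinForm.orthogonal_le inf_le_left
    · exact LinearMap.BilinForm.orthogonal_le inf_le_right

/-- An isotropic subspace of half the dimension is its own orthogonal complement. -/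
theorem LinearMap.BilinForm.orthogonal_eq_self_of_isotropic {V : Type*} [AddCommGroup V]
    [Module K V] [FiniteDimensional K V] {B : LinearMap.BilinForm K V} (hB : B.Nondegenerate)
    {W : Submodule K V} (hW : ∀ v ∈ W, ∀ w ∈ W, B v w = 0)
    (hdim : finrank K V = 2 * finrank K W) : B.orthogonal W = W := by
  have hle : W ≤ B.orthogonal W := fun w hw v hv => hW v hv w hw
  refine (Submodule.eq_of_le_of_finrank_eq hle ?_).symm
  rw [LinearMap.BilinForm.finrank_orthogonal hB]
  omega

/-- A subspace which is its own orthogonal complement has half the dimension. -/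
theorem LinearMap.BilinForm.finrank_eq_two_mul_of_orthogonal_eq_self {V : Type*}
    [AddCommGroup V] [Module K V] [FiniteDimensional K V] {B : LinearMap.BilinForm K V}
    (hB : B.Nondegenerate) {W : Submodule K V} (hW : B.orthogonal W = W) :
    finrank K V = 2 * finrank K W := by
  have h := LinearMap.BilinForm.finrank_orthogonal hB W
  have := W.finrank_le
  rw [hW] at h
  omega

variable (K ι) in
/-- The standard symplectic form on `K^ι ⊕ K^ι`. -/
def sympForm [Fintype ι] : LinearMap.BilinForm K ((ι → K) × (ι → K)) :=
  LinearMap.mk₂ K (fun x y => x.1 ⬝ᵥ y.2 - x.2 ⬝ᵥ y.1)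
    (fun _ _ _ => by simp [add_dotProduct]; ring)
    (fun _ _ _ => by simp [smul_dotProduct, mul_sub])
    (fun _ _ _ => by simp [dotProduct_add]; ring)
    (fun _ _ _ => by simp [dotProduct_smul, mul_sub])

theorem sympForm_apply [Fintype ι] (x y : (ι → K) × (ι → K)) :
    sympForm K ι x y = x.1 ⬝ᵥ y.2 - x.2 ⬝ᵥ y.1 := rfl

theorem sympForm_isAlt [Fintype ι] : (sympForm K ι).IsAlt := fun x => by
  rw [sympForm_apply, dotProduct_comm, sub_self]

theorem LinearMap.IsRefl.nondegenerate_of_separatingRight {V : Type*} [AddCommGroup V]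
    [Module K V] {B : LinearMap.BilinForm K V} (hB : B.IsRefl) (h : B.SeparatingRight) :
    B.Nondegenerate :=
  ⟨fun x hx => h x fun y => hB _ _ (hx y), h⟩

theorem sympForm_nondegenerate [Fintype ι] : (sympForm K ι).Nondegenerate := by
  refine IsRefl.nondegenerate_of_separatingRight sympForm_isAlt.isRefl fun y hy => ?_
  refine Prod.ext (dotProduct_eq_zero _ fun w => ?_) (dotProduct_eq_zero _ fun w => ?_)
  · simpa [sympForm_apply, dotProduct_comm] using hy (0, w)
  · simpa [sympForm_apply, dotProduct_comm] using hy (w, 0)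

variable (K ι) in
/-- The difference of two copies of the standard symplectic form. -/
def sympDiff [Fintype ι] :
    LinearMap.BilinForm K (((ι → K) × (ι → K)) × ((ι → K) × (ι → K))) :=
  (sympForm K ι).compl₁₂ (fst K _ _) (fst K _ _) - (sympForm K ι).compl₁₂ (snd K _ _) (snd K _ _)

theorem sympDiff_apply [Fintype ι] (z w : ((ι → K) × (ι → K)) × ((ι → K) × (ι → K))) :
    sympDiff K ι z w = sympForm K ι z.1 w.1 - sympForm K ι z.2 w.2 := rfl

theorem sympDiff_isAlt [Fintype ι] : (sympDiff K ι).IsAlt := fun x => by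
  rw [sympDiff_apply, sympForm_isAlt.self_eq_zero, sympForm_isAlt.self_eq_zero, sub_self]

theorem sympDiff_nondegenerate [Fintype ι] : (sympDiff K ι).Nondegenerate := by
  refine IsRefl.nondegenerate_of_separatingRight sympDiff_isAlt.isRefl fun y hy => ?_
  refine Prod.ext (sympForm_nondegenerate.2 _ fun w => ?_)
    (sympForm_nondegenerate.2 _ fun w => ?_)
  · simpa [sympDiff_apply] using hy (w, 0)
  · simpa [sympDiff_apply] using hy (0, w)

/-- The subspace of all `(u⁺ ⊕ u⁻) ⊕ (v⁺ ⊕ v⁻)` with `v⁺ = M u⁺` and `u⁻ = Mᵗ v⁻`. -/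
def sympGraph [Fintype ι] (M : Matrix ι ι K) :
    Submodule K (((ι → K) × (ι → K)) × ((ι → K) × (ι → K))) where
  carrier := {z | z.2.1 = M *ᵥ z.1.1 ∧ z.1.2 = Mᵀ *ᵥ z.2.2}
  zero_mem' := by simp
  add_mem' := by
    rintro z w ⟨hz, hz'⟩ ⟨hw, hw'⟩
    simp [mulVec_add, hz, hz', hw, hw']
  smul_mem' := by
    rintro c z ⟨hz, hz'⟩
    simp [mulVec_smul, hz, hz']

theorem mulVec_dotProduct_eq [Fintype ι] (M : Matrix ι ι K) (x y : ι → K) :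
    (M *ᵥ x) ⬝ᵥ y = x ⬝ᵥ (Mᵀ *ᵥ y) := by
  rw [mulVec_transpose, dotProduct_comm, dotProduct_mulVec, dotProduct_comm]

theorem sympGraph_isotropic [Fintype ι] (M : Matrix ι ι K)
    {z w : ((ι → K) × (ι → K)) × ((ι → K) × (ι → K))}
    (hz : z ∈ sympGraph M) (hw : w ∈ sympGraph M) : sympDiff K ι z w = 0 := by
  rw [sympDiff_apply, sympForm_apply, sympForm_apply, hz.1, hz.2, hw.1, hw.2,
    mulVec_dotProduct_eq, mulVec_dotProduct_eq, transpose_transpose]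
  ring

theorem orthogonal_sympGraph_le [Fintype ι] (M : Matrix ι ι K) :
    (sympDiff K ι).orthogonal (sympGraph M) ≤ sympGraph M := by
  intro z hz
  refine ⟨dotProduct_eq _ _ fun v => ?_, dotProduct_eq _ _ fun u => ?_⟩
  · have h := hz ((0, Mᵀ *ᵥ v), (0, v)) ⟨by simp, rfl⟩
    simp only [sympDiff_apply, sympForm_apply, zero_dotProduct, mulVec_dotProduct_eq,
      transpose_transpose] at h
    rw [dotProduct_comm, dotProduct_comm (M *ᵥ _)]
    linear_combination h
  · have h := hz ((u, 0), (M *ᵥ u, 0)) ⟨rfl, by simp⟩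
    simp only [sympDiff_apply, sympForm_apply, zero_dotProduct, mulVec_dotProduct_eq] at h
    rw [dotProduct_comm, dotProduct_comm (Mᵀ *ᵥ _)]
    linear_combination h

variable (K α κ μ) in
/-- The projection onto the coordinates indexed by `α`. -/
def basePart : ((α ⊕ κ × μ → K) × (α ⊕ κ × μ → K)) →ₗ[K] (α → K) × (α → K) :=
  (funLeft K K Sum.inl).prodMap (funLeft K K Sum.inl)

variable (K α) in
/-- The projection onto the coordinates indexed by `κ × {s}`. -/
def slicePart (κ : Type*) {μ : Type*} (s : μ) :
    ((α ⊕ κ × μ → K) × (α ⊕ κ × μ → K)) →ₗ[K] (κ → K) × (κ → K) :=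
  (funLeft K K fun j => Sum.inr (j, s)).prodMap (funLeft K K fun j => Sum.inr (j, s))

/-- The vector with prescribed base part and slices. -/
def ofParts (a : (α → K) × (α → K)) (q : μ → (κ → K) × (κ → K)) :
    (α ⊕ κ × μ → K) × (α ⊕ κ × μ → K) :=
  (Sum.elim a.1 fun js => (q js.2).1 js.1, Sum.elim a.2 fun js => (q js.2).2 js.1)

@[simp]
theorem basePart_ofParts (a : (α → K) × (α → K)) (q : μ → (κ → K) × (κ → K)) :
    basePart K α κ μ (ofParts a q) = a := rfl

@[simp]
theorem slicePart_ofParts (a : (α → K) × (α → K)) (q : μ → (κ → K) × (κ → K)) (s : μ) :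
    slicePart K α κ s (ofParts a q) = q s := rfl

/-- The subspace of vectors all of whose slices lie in `Q`. -/
def slicesIn (α μ : Type*) (Q : Submodule K ((κ → K) × (κ → K))) :
    Submodule K ((α ⊕ κ × μ → K) × (α ⊕ κ × μ → K)) :=
  ⨅ s : μ, Q.comap (slicePart K α κ s)

theorem mem_slicesIn {Q : Submodule K ((κ → K) × (κ → K))}
    {z : (α ⊕ κ × μ → K) × (α ⊕ κ × μ → K)} :
    z ∈ slicesIn α μ Q ↔ ∀ s, slicePart K α κ s z ∈ Q := by
  simp [slicesIn]

variable [Fintype α] [Fintype κ] [Fintype μ]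

theorem sympForm_eq_parts (z w : (α ⊕ κ × μ → K) × (α ⊕ κ × μ → K)) :
    sympForm K (α ⊕ κ × μ) z w =
      sympForm K α (basePart K α κ μ z) (basePart K α κ μ w) +
        ∑ s, sympForm K κ (slicePart K α κ s z) (slicePart K α κ s w) := by
  simp only [sympForm_apply, dotProduct, Fintype.sum_sum_type, Fintype.sum_prod_type_right,
    Finset.sum_sub_distrib]
  simp only [basePart, slicePart, prodMap_apply, funLeft_apply]
  ring

theorem sympForm_eq_base_of_mem_slicesIn {Q : Submodule K ((κ → K) × (κ → K))}
    (hQ : ∀ v ∈ Q, ∀ w ∈ Q, sympForm K κ v w = 0)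
    {z w : (α ⊕ κ × μ → K) × (α ⊕ κ × μ → K)}
    (hz : z ∈ slicesIn α μ Q) (hw : w ∈ slicesIn α μ Q) :
    sympForm K (α ⊕ κ × μ) z w = sympForm K α (basePart K α κ μ z) (basePart K α κ μ w) := by
  rw [sympForm_eq_parts, Finset.sum_eq_zero, add_zero]
  exact fun s _ => hQ _ (mem_slicesIn.1 hz s) _ (mem_slicesIn.1 hw s)

theorem basePart_eq_zero_of_mem_orthogonal {Q : Submodule K ((κ → K) × (κ → K))}
    {z : (α ⊕ κ × μ → K) × (α ⊕ κ × μ → K)}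
    (hz : z ∈ (sympForm K (α ⊕ κ × μ)).orthogonal (slicesIn α μ Q)) :
    basePart K α κ μ z = 0 := by
  refine sympForm_nondegenerate.2 _ fun a => ?_
  have h := hz (ofParts a 0) (mem_slicesIn.2 fun s => by simp)
  simpa [sympForm_eq_parts] using h

theorem orthogonal_slicesIn_le {Q : Submodule K ((κ → K) × (κ → K))} :
    (sympForm K (α ⊕ κ × μ)).orthogonal (slicesIn α μ Q) ≤
      slicesIn α μ ((sympForm K κ).orthogonal Q) := by
  classical
  intro z hz
  refine mem_slicesIn.2 fun s q hq => ?_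
  have h := hz (ofParts 0 (Pi.single s q)) (mem_slicesIn.2 fun t => by
    rw [slicePart_ofParts]
    by_cases hts : t = s
    · subst hts; simpa using hq
    · simp [hts])
  rw [sympForm_eq_parts, Finset.sum_eq_single s] at h
  · simpa using h
  · intro t _ hts
    simp [hts]
  · simp

/-- The symplectic reduction of the graph of `M` along the subspaces `Q` and `T`. -/
def chiSubmodule (M : Matrix (α ⊕ κ × μ) (α ⊕ κ × μ) K)
    (Q T : Submodule K ((κ → K) × (κ → K))) :
    Submodule K (((α → K) × (α → K)) × ((α → K) × (α → K))) :=
  (sympGraph M ⊓ (slicesIn α μ Q).prod (slicesIn α μ T)).map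
    ((basePart K α κ μ).prodMap (basePart K α κ μ))

theorem chiSubmodule_isotropic (M : Matrix (α ⊕ κ × μ) (α ⊕ κ × μ) K)
    {Q T : Submodule K ((κ → K) × (κ → K))}
    (hQ : ∀ v ∈ Q, ∀ w ∈ Q, sympForm K κ v w = 0)
    (hT : ∀ v ∈ T, ∀ w ∈ T, sympForm K κ v w = 0) :
    ∀ z ∈ chiSubmodule M Q T, ∀ w ∈ chiSubmodule M Q T, sympDiff K α z w = 0 := by
  rintro _ ⟨z, ⟨hzG, hzD⟩, rfl⟩ _ ⟨w, ⟨hwG, hwD⟩, rfl⟩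
  rw [← sympGraph_isotropic M hzG hwG, sympDiff_apply, sympDiff_apply,
    sympForm_eq_base_of_mem_slicesIn hQ hzD.1 hwD.1,
    sympForm_eq_base_of_mem_slicesIn hT hzD.2 hwD.2]
  rfl

theorem orthogonal_prod_le [Fintype ι] (D E : Submodule K ((ι → K) × (ι → K))) :
    (sympDiff K ι).orthogonal (D.prod E) ≤
      ((sympForm K ι).orthogonal D).prod ((sympForm K ι).orthogonal E) := by
  refine fun z hz => ⟨fun w hw => ?_, fun w hw => ?_⟩
  · simpa [sympDiff_apply] using hz (w, 0) ⟨hw, E.zero_mem⟩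
  · simpa [sympDiff_apply] using hz (0, w) ⟨D.zero_mem, hw⟩

theorem orthogonal_chiSubmodule_le (M : Matrix (α ⊕ κ × μ) (α ⊕ κ × μ) K)
    {Q T : Submodule K ((κ → K) × (κ → K))}
    (hQ : (sympForm K κ).orthogonal Q ≤ Q) (hT : (sympForm K κ).orthogonal T ≤ T) :
    (sympDiff K α).orthogonal (chiSubmodule M Q T) ≤ chiSubmodule M Q T := by
  intro a ha
  have hmem : (ofParts a.1 0, ofParts a.2 0) ∈ (sympDiff K (α ⊕ κ × μ)).orthogonal
      (sympGraph M ⊓ (slicesIn α μ Q).prod (slicesIn α μ T)) := by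
    intro w hw
    have h := ha _ (Submodule.mem_map_of_mem hw)
    rw [sympDiff_apply] at h
    simpa [sympDiff_apply, sympForm_eq_parts] using h
  rw [LinearMap.BilinForm.orthogonal_inf sympDiff_nondegenerate sympDiff_isAlt.isRefl] at hmem
  obtain ⟨g, hg, d, hd, hgd⟩ := Submodule.mem_sup.1 hmem
  obtain ⟨hd₁, hd₂⟩ := orthogonal_prod_le _ _ hd
  have h₁ : g.1 + d.1 = ofParts a.1 0 := congrArg Prod.fst hgd
  have h₂ : g.2 + d.2 = ofParts a.2 0 := congrArg Prod.snd hgd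
  refine ⟨g, ⟨orthogonal_sympGraph_le M hg, ?_, ?_⟩, Prod.ext ?_ ?_⟩
  · refine mem_slicesIn.2 fun s => hQ ?_
    have h := congrArg (slicePart K α κ s) h₁
    rw [map_add, slicePart_ofParts, Pi.zero_apply, add_eq_zero_iff_eq_neg] at h
    exact h ▸ neg_mem (mem_slicesIn.1 (orthogonal_slicesIn_le hd₁) s)
  · refine mem_slicesIn.2 fun s => hT ?_
    have h := congrArg (slicePart K α κ s) h₂
    rw [map_add, slicePart_ofParts, Pi.zero_apply, add_eq_zero_iff_eq_neg] at h
    exact h ▸ neg_mem (mem_slicesIn.1 (orthogonal_slicesIn_le hd₂) s)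
  · have h := congrArg (basePart K α κ μ) h₁
    rwa [map_add, basePart_eq_zero_of_mem_orthogonal hd₁, add_zero, basePart_ofParts] at h
  · have h := congrArg (basePart K α κ μ) h₂
    rwa [map_add, basePart_eq_zero_of_mem_orthogonal hd₂, add_zero, basePart_ofParts] at h

end SymplecticReduction

theorem sympForm_eq_Bform (p : ℕ) [Fact p.Prime] (n : ℕ) (x y : SpV p n) :
    sympForm ℚ_[p] (Fin n) x y = Bform p n x y := by
  simp [sympForm_apply, Bform, dotProduct]

theorem sympDiff_eq_Bminus (p : ℕ) [Fact p.Prime] (n : ℕ) (x y : SpV p n × SpV p n) :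
    sympDiff ℚ_[p] (Fin n) x y = Bminus p n x y := by
  simp [sympDiff_apply, Bminus, sympForm_eq_Bform]

theorem coe_chiSubmodule (p : ℕ) [Fact p.Prime] (α k m : ℕ)
    (M : Matrix (BigIx α k m) (BigIx α k m) ℚ_[p]) (Q T : Submodule ℚ_[p] (SpV p k)) :
    (chiSubmodule M Q T : Set (SpV p α × SpV p α)) = chiM p α k m M Q T := by
  ext uv
  constructor
  · rintro ⟨z, ⟨⟨hG₁, hG₂⟩, hQ, hT⟩, rfl⟩
    refine ⟨fun j s => z.1.1 (Sum.inr (j, s)), fun j s => z.1.2 (Sum.inr (j, s)),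
      fun j s => z.2.1 (Sum.inr (j, s)), fun j s => z.2.2 (Sum.inr (j, s)),
      mem_slicesIn.1 hQ, mem_slicesIn.1 hT, ?_, ?_⟩
    · exact (Sum.elim_comp_inl_inr _).trans
        (hG₁.trans (congrArg _ (Sum.elim_comp_inl_inr z.1.1).symm))
    · exact (Sum.elim_comp_inl_inr _).trans
        (hG₂.trans (congrArg _ (Sum.elim_comp_inl_inr z.2.2).symm))
  · rintro ⟨xp, xm, yp, ym, hQ, hT, h₁, h₂⟩
    exact ⟨((glue uv.1.1 xp, glue uv.1.2 xm), (glue uv.2.1 yp, glue uv.2.2 ym)),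
      ⟨⟨h₁, h₂⟩, mem_slicesIn.2 hQ, mem_slicesIn.2 hT⟩, rfl⟩

theorem orthogonal_eq_self_of_lagrangian {p : ℕ} [Fact p.Prime] {k : ℕ}
    {Q : Submodule ℚ_[p] (SpV p k)} (hdim : finrank ℚ_[p] Q = k)
    (hiso : ∀ v ∈ Q, ∀ w ∈ Q, Bform p k v w = 0) :
    (sympForm ℚ_[p] (Fin k)).orthogonal Q = Q := by
  refine LinearMap.BilinForm.orthogonal_eq_self_of_isotropic sympForm_nondegenerate
    (fun v hv w hw => (sympForm_eq_Bform p k v w).trans (hiso v hv w hw)) ?_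
  rw [hdim, finrank_prod, finrank_fin_fun]
  ring

/-- **Values on the distinguished boundary:** if `Q` and `T` are Lagrangian `ℚ_p`-subspaces
of `H` (`k`-dimensional subspaces on which `B_H` vanishes), then for every
`g ∈ GL(α + km, ℚ_p)` the set `χ_g(Q, T)` is a Lagrangian subspace of `(V ⊕ V, B^⊖)`: a
`ℚ_p`-linear subspace of dimension `2α` on which `B^⊖` vanishes identically. -/
theorem chi_lagrangian_boundary (p : ℕ) [Fact p.Prime] (α k m : ℕ)
    (hk : 1 ≤ k) (hm : 1 ≤ m)
    (M : Matrix (BigIx α k m) (BigIx α k m) ℚ_[p]) (hM : IsUnit M)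
    (Q T : Submodule ℚ_[p] (SpV p k))
    (hQdim : Module.finrank ℚ_[p] Q = k) (hTdim : Module.finrank ℚ_[p] T = k)
    (hQiso : ∀ v ∈ Q, ∀ w ∈ Q, Bform p k v w = 0)
    (hTiso : ∀ v ∈ T, ∀ w ∈ T, Bform p k v w = 0) :
    (Submodule.span ℚ_[p] (chiM p α k m M (Q : Set (SpV p k)) (T : Set (SpV p k))) :
        Set (SpV p α × SpV p α)) =
      chiM p α k m M (Q : Set (SpV p k)) (T : Set (SpV p k)) ∧
    Module.finrank ℚ_[p]
      (Submodule.span ℚ_[p] (chiM p α k m M (Q : Set (SpV p k)) (T : Set (SpV p k)))) =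
      2 * α ∧
    (∀ z ∈ chiM p α k m M (Q : Set (SpV p k)) (T : Set (SpV p k)),
      ∀ z' ∈ chiM p α k m M (Q : Set (SpV p k)) (T : Set (SpV p k)),
        Bminus p α z z' = 0) := by
  have hQ : ∀ v ∈ Q, ∀ w ∈ Q, sympForm ℚ_[p] (Fin k) v w = 0 :=
    fun v hv w hw => (sympForm_eq_Bform p k v w).trans (hQiso v hv w hw)
  have hT : ∀ v ∈ T, ∀ w ∈ T, sympForm ℚ_[p] (Fin k) v w = 0 :=
    fun v hv w hw => (sympForm_eq_Bform p k v w).trans (hTiso v hv w hw)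
  have hiso := chiSubmodule_isotropic M hQ hT
  rw [← coe_chiSubmodule, Submodule.span_eq]
  refine ⟨rfl, ?_, fun z hz w hw => (sympDiff_eq_Bminus p α z w).symm.trans (hiso z hz w hw)⟩
  have horth := (orthogonal_chiSubmodule_le M (orthogonal_eq_self_of_lagrangian hQdim hQiso).le
    (orthogonal_eq_self_of_lagrangian hTdim hTiso).le).antisymm
      fun w hw z hz => hiso z hz w hw
  have h := LinearMap.BilinForm.finrank_eq_two_mul_of_orthogonal_eq_self
    sympDiff_nondegenerate horth
  simp only [finrank_prod, finrank_fin_fun] at h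
  refine Nat.eq_of_mul_eq_mul_left two_pos (h.symm.trans ?_)
  ring
end
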